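/- arXiv:1603.08073 — 3 statements merged into one kernel-verified Lean document; each statement's English description precedes it below -/
import Mathlib

section
/- Let G = (V,E) be a simple undirected graph with positive integer edge weights w, and let A, B ⊆ V be disjoint sets of even cardinality such that no edge of G has both endpoints in A ∪ B. Let H, S, and S' be as in the Gallai construction, let τ := (|A|+|B|)/2, and for a perfect (A+B)-path packing 𝓟 let w(𝓟) be its size and θ(𝓟) the number of its B-paths having an even number of edges. Then haf S' = Σ_𝓟 (−1)^{θ(𝓟)} · 2^τ · x^{w(𝓟)} · (1 + x·f_𝓟(x)), where 𝓟 ranges over all perfect (A+B)-path packings of G and each f_𝓟(x) is some polynomial with integer coefficients. -/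
open scoped Classical

-- The hafnian of a matrix: the sum over all partitions of the index set into
-- unordered pairs (encoded as fixed-point-free involutions, taking each pair once)
-- of the product of the corresponding entries.  For symmetric matrices this is the
-- usual hafnian.
noncomputable def haf {ι : Type*} [Fintype ι] {R : Type*} [CommRing R]
    (M : Matrix ι ι R) : R :=
  ∑ σ ∈ Finset.univ.filter
      (fun σ : Equiv.Perm ι => σ * σ = 1 ∧ ∀ i, σ i ≠ i),
    ∏ i ∈ Finset.univ.filter
      (fun i => Fintype.equivFin ι i < Fintype.equivFin ι (σ i)),
      M i (σ i)

/-- The vertex set `V_H = V ⊔ U'` of Gallai's auxiliary graph `H`, where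
`U' = {v' : v ∈ U}` is a disjoint copy of `U = V \ (A ∪ B)`.  The left summand is
the original vertex set `V = A ∪ B ∪ U` and the right summand is the copy `U'`. -/
abbrev GallaiVertex {V : Type*} [DecidableEq V] (A B : Finset V) : Type _ :=
  V ⊕ {v : V // v ∉ A ∧ v ∉ B}

/-- The matrix `S'` of the Gallai construction for terminal sets `A, B`, over `ℤ[x]`:
it is indexed by `V_H`, has zero diagonal, entry `x^{w(ij)}` for each edge `ij` of
`H = (V_H, E ∪ E' ∪ E_=)` (where `E_=`-edges `v v'` have weight `0`, so entry `1`),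
with the entries corresponding to edges of `E'_t` for `t ∈ B` (edges joining
`t ∈ B` to the copy `U'`) negated, and entry `0` otherwise. -/
noncomputable def gallaiSP {V : Type*} [DecidableEq V] (G : SimpleGraph V)
    [DecidableRel G.Adj] (w : Sym2 V → ℕ) (A B : Finset V) :
    Matrix (GallaiVertex A B) (GallaiVertex A B) (Polynomial ℤ) :=
  Matrix.of fun a b =>
    match a, b with
    | Sum.inl u, Sum.inl v =>
        if G.Adj u v then Polynomial.X ^ w s(u, v) else 0
    | Sum.inl u, Sum.inr v =>
        if u = v.1 then 1
        else if (u ∈ A ∪ B) ∧ G.Adj u v.1 then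
          (if u ∈ B then -Polynomial.X ^ w s(u, v.1) else Polynomial.X ^ w s(u, v.1))
        else 0
    | Sum.inr v, Sum.inl u =>
        if u = v.1 then 1
        else if (u ∈ A ∪ B) ∧ G.Adj u v.1 then
          (if u ∈ B then -Polynomial.X ^ w s(u, v.1) else Polynomial.X ^ w s(u, v.1))
        else 0
    | Sum.inr u, Sum.inr v =>
        if G.Adj u.1 v.1 then Polynomial.X ^ w s(u.1, v.1) else 0

/-- A path of `G`, recorded with its two endpoints. -/
abbrev PathSig {V : Type*} (G : SimpleGraph V) : Type _ :=
  Σ u v : V, {p : G.Walk u v // p.IsPath}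

/-- A perfect `(A+B)`-path packing: a set of `|A|/2 + |B|/2` vertex-disjoint paths
of `G`, each connecting two distinct vertices of `A` or two distinct vertices of
`B`.  Each path is recorded with its endpoints in increasing order, so that every
(undirected) path appears in exactly one orientation. -/
def IsPerfectABPacking {V : Type*} [LinearOrder V] (G : SimpleGraph V)
    (A B : Finset V) (P : Finset (PathSig G)) : Prop :=
  (∀ p ∈ P, p.1 < p.2.1) ∧
  (∀ p ∈ P, (p.1 ∈ A ∧ p.2.1 ∈ A) ∨ (p.1 ∈ B ∧ p.2.1 ∈ B)) ∧
  (∀ p ∈ P, ∀ q ∈ P, p ≠ q →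
    ∀ v : V, v ∈ p.2.2.1.support → v ∉ q.2.2.1.support) ∧
  P.card = A.card / 2 + B.card / 2

/-- The size `w(𝓟)` of a path packing: the total weight of the edges of its paths. -/
def packingWeight {V : Type*} {G : SimpleGraph V} (w : Sym2 V → ℕ)
    (P : Finset (PathSig G)) : ℕ :=
  ∑ p ∈ P, (p.2.2.1.edges.map w).sum

/-- `θ(𝓟)`: the number of paths of `𝓟` with both ends in `B` and an even number of
edges. -/
def thetaB {V : Type*} [DecidableEq V] {G : SimpleGraph V} (B : Finset V)
    (P : Finset (PathSig G)) : ℕ :=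
  (P.filter (fun p => p.1 ∈ B ∧ p.2.1 ∈ B ∧ Even p.2.2.1.length)).card

/-- The hafnian of the submatrix of `M` on the index set `s`: the sum over the involutions
whose set of moved points is `s`. -/
noncomputable def hafOn {ι : Type*} [Fintype ι] {R : Type*} [CommRing R]
    (M : Matrix ι ι R) (s : Finset ι) : R :=
  ∑ σ ∈ Finset.univ.filter
      (fun σ : Equiv.Perm ι => σ * σ = 1 ∧ ∀ i, σ i ≠ i ↔ i ∈ s),
    ∏ i ∈ s.filter (fun i => Fintype.equivFin ι i < Fintype.equivFin ι (σ i)), M i (σ i)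

section Hafnian

variable {ι : Type*} [Fintype ι] {R : Type*} [CommRing R]

theorem haf_eq_hafOn_univ (M : Matrix ι ι R) : haf M = hafOn M Finset.univ := by
  simp [haf, hafOn]

theorem hafOn_empty (M : Matrix ι ι R) : hafOn M ∅ = 1 := by
  have h : Finset.univ.filter
      (fun σ : Equiv.Perm ι => σ * σ = 1 ∧ ∀ i, σ i ≠ i ↔ i ∈ (∅ : Finset ι)) = {1} := by
    ext σ
    simp only [Finset.mem_filter, Finset.mem_univ, true_and, Finset.notMem_empty, iff_false,
      not_not, Finset.mem_singleton]
    exact ⟨fun h => Equiv.ext h.2, fun h => by simp [h]⟩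
  rw [hafOn, h]
  simp

theorem hafOn_congr {M N : Matrix ι ι R} {s : Finset ι}
    (h : ∀ i ∈ s, ∀ j ∈ s, M i j = N i j) : hafOn M s = hafOn N s := by
  refine Finset.sum_congr rfl fun σ hσ => Finset.prod_congr rfl fun i hi => ?_
  simp only [Finset.mem_filter, Finset.mem_univ, true_and] at hσ hi
  refine h i hi.1 _ ((hσ.2 _).1 fun h' => ?_)
  exact (hσ.2 i).2 hi.1 (σ.injective h')

/-- Expansion of the hafnian along the row `i`. -/
theorem hafOn_expand [DecidableEq ι] {M : Matrix ι ι R} (hM : ∀ i j, M i j = M j i) {s : Finset ι} {i : ι}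
    (hi : i ∈ s) :
    hafOn M s = ∑ j ∈ s.erase i, M i j * hafOn M ((s.erase i).erase j) := by
  unfold hafOn
  rw [← Finset.sum_fiberwise_of_maps_to (t := s.erase i) (g := fun σ : Equiv.Perm ι => σ i)]
  swap
  · intro σ hσ
    simp only [Finset.mem_filter, Finset.mem_univ, true_and] at hσ
    refine Finset.mem_erase.2 ⟨(hσ.2 i).2 hi, (hσ.2 _).1 fun h' => ?_⟩
    exact (hσ.2 i).2 hi (σ.injective h')
  refine Finset.sum_congr rfl fun j hj => ?_
  obtain ⟨hji, hjs⟩ := Finset.mem_erase.1 hj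
  rw [Finset.mul_sum]
  refine Finset.sum_bij' (fun σ _ => Equiv.swap i j * σ) (fun σ _ => Equiv.swap i j * σ)
    ?_ ?_ ?_ ?_ ?_
  · intro σ hσ
    simp only [Finset.mem_filter, Finset.mem_univ, true_and, Equiv.ext_iff, Equiv.Perm.mul_apply,
      Equiv.Perm.one_apply, Finset.mem_erase] at hσ ⊢
    obtain ⟨⟨h1, h2⟩, h3⟩ := hσ
    have h4 : σ j = i := by rw [← h3, h1]
    have h5 : ∀ k, k ≠ i → k ≠ j → σ k ≠ i ∧ σ k ≠ j := by
      intro k hki hkj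
      exact ⟨fun h => hkj (by rw [← h1 k, h, h3]), fun h => hki (by rw [← h1 k, h, h4])⟩
    have key : ∀ k, Equiv.swap i j (σ k) = if k = i then i else if k = j then j else σ k := by
      intro k
      split_ifs with ha hb
      · rw [ha, h3, Equiv.swap_apply_right]
      · rw [hb, h4, Equiv.swap_apply_left]
      · exact Equiv.swap_apply_of_ne_of_ne (h5 k ha hb).1 (h5 k ha hb).2
    constructor
    · intro k
      rw [key k]
      split_ifs with ha hb
      · rw [key, if_pos rfl, ha]
      · rw [key, if_neg hji, if_pos rfl, hb]
      · rw [key, if_neg (h5 k ha hb).1, if_neg (h5 k ha hb).2, h1]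
    · intro k
      rw [key k]
      have := h2 k
      split_ifs with ha hb <;> grind
  · intro σ hσ
    simp only [Finset.mem_filter, Finset.mem_univ, true_and, Equiv.ext_iff, Equiv.Perm.mul_apply,
      Equiv.Perm.one_apply, Finset.mem_erase] at hσ ⊢
    obtain ⟨h1, h2⟩ := hσ
    have h3 : σ i = i := by
      by_contra h
      exact ((h2 i).1 h).2.1 rfl
    have h4 : σ j = j := by
      by_contra h
      exact ((h2 j).1 h).1 rfl
    have h5 : ∀ k, k ≠ i → k ≠ j → σ k ≠ i ∧ σ k ≠ j := by
      intro k hki hkj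
      exact ⟨fun h => hki (by rw [← h1 k, h, h3]), fun h => hkj (by rw [← h1 k, h, h4])⟩
    have key : ∀ k, Equiv.swap i j (σ k) = if k = i then j else if k = j then i else σ k := by
      intro k
      split_ifs with ha hb
      · rw [ha, h3, Equiv.swap_apply_left]
      · rw [hb, h4, Equiv.swap_apply_right]
      · exact Equiv.swap_apply_of_ne_of_ne (h5 k ha hb).1 (h5 k ha hb).2
    refine ⟨⟨?_, ?_⟩, ?_⟩
    · intro k
      rw [key k]
      split_ifs with ha hb
      · rw [key, if_neg hji, if_pos rfl, ha]
      · rw [key, if_pos rfl, hb]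
      · rw [key, if_neg (h5 k ha hb).1, if_neg (h5 k ha hb).2, h1]
    · intro k
      rw [key k]
      have := h2 k
      split_ifs with ha hb <;> grind
    · rw [key, if_pos rfl]
  · intro σ _
    rw [← mul_assoc, Equiv.swap_mul_self, one_mul]
  · intro σ _
    rw [← mul_assoc, Equiv.swap_mul_self, one_mul]
  · intro σ hσ
    simp only [Finset.mem_filter, Finset.mem_univ, true_and, Equiv.ext_iff, Equiv.Perm.mul_apply,
      Equiv.Perm.one_apply] at hσ
    obtain ⟨⟨h1, h2⟩, h3⟩ := hσ
    have h4 : σ j = i := by rw [← h3, h1]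
    have h6 : ∀ k ∈ (s.erase i).erase j, Equiv.swap i j (σ k) = σ k := by
      intro k hk
      simp only [Finset.mem_erase] at hk
      exact Equiv.swap_apply_of_ne_of_ne
        (fun h => hk.1 (by rw [← h1 k, h, h3])) (fun h => hk.2.1 (by rw [← h1 k, h, h4]))
    have h7 : ∏ k ∈ ((s.erase i).erase j).filter (fun k => Fintype.equivFin ι k <
          Fintype.equivFin ι ((Equiv.swap i j * σ) k)), M k ((Equiv.swap i j * σ) k) =
        ∏ k ∈ ((s.erase i).erase j).filter (fun k => Fintype.equivFin ι k <
          Fintype.equivFin ι (σ k)), M k (σ k) := by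
      rw [Finset.prod_filter, Finset.prod_filter]
      refine Finset.prod_congr rfl fun k hk => ?_
      rw [Equiv.Perm.mul_apply, h6 k hk]
    rw [h7, Finset.prod_filter, ← Finset.mul_prod_erase s _ hi, ← Finset.mul_prod_erase _ _ hj,
      Finset.prod_filter, ← mul_assoc]
    congr 1
    rw [h3, h4]
    have hne : Fintype.equivFin ι i ≠ Fintype.equivFin ι j :=
      fun h => hji ((Fintype.equivFin ι).injective h).symm
    rcases lt_or_gt_of_ne hne with h | h
    · rw [if_pos h, if_neg h.not_gt, mul_one]
    · rw [if_neg h.not_gt, if_pos h, one_mul, hM]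

theorem hafOn_map [DecidableEq ι] {κ : Type*} [Fintype κ] [DecidableEq κ] (e : ι ↪ κ) {M : Matrix ι ι R} {N : Matrix κ κ R}
    (hN : ∀ i j, N i j = N j i) (h : ∀ i j, M i j = N (e i) (e j)) (s : Finset ι) :
    hafOn M s = hafOn N (s.map e) := by
  induction s using Finset.strongInduction with
  | H s ih =>
    rcases s.eq_empty_or_nonempty with rfl | ⟨i, hi⟩
    · simp [hafOn_empty]
    · rw [hafOn_expand (fun i j => by rw [h, h, hN]) hi,
        hafOn_expand hN (Finset.mem_map_of_mem e hi), ← Finset.map_erase, Finset.sum_map]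
      refine Finset.sum_congr rfl fun j _ => ?_
      rw [← Finset.map_erase, ← ih _ ?_, h]
      exact (Finset.erase_subset _ _).trans_ssubset (Finset.erase_ssubset hi)

end Hafnian

section Doubled

variable {V : Type*} {R : Type*} [CommRing R]

/-- The vertex of `V` underlying an element of the doubled vertex set. -/
def baseVertex : V ⊕ V → V := Sum.elim id id

/-- The standard bilinear form on `R × R`. -/
def pairDot (a b : R × R) : R := a.1 * b.1 + a.2 * b.2

theorem pairDot_comm (a b : R × R) : pairDot a b = pairDot b a := by
  simp only [pairDot]; ring

variable [DecidableEq V]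

/-- The vectors attached to the doubled vertex set: the two copies of a vertex of `U` carry the two
standard basis vectors, and a terminal `v` carries `c v`. -/
def layerVec (c : V → R × R) (U : Finset V) : V ⊕ V → R × R
  | Sum.inl v => if v ∈ U then (1, 0) else c v
  | Sum.inr _ => (0, 1)

/-- The weighted adjacency matrix of the doubled graph, in which the edges between different base
vertices are weighted by the product of the weight `g` and the form `pairDot`. -/
def doubledMatrix (g : V → V → R) (c : V → R × R) (U : Finset V) : Matrix (V ⊕ V) (V ⊕ V) R :=
  Matrix.of fun i j => g (baseVertex i) (baseVertex j) * pairDot (layerVec c U i) (layerVec c U j) +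
    if i ≠ j ∧ baseVertex i = baseVertex j then 1 else 0

theorem doubledMatrix_symm {g : V → V → R} (hg : ∀ u v, g u v = g v u) (c : V → R × R)
    (U : Finset V) (i j : V ⊕ V) : doubledMatrix g c U i j = doubledMatrix g c U j i := by
  simp only [doubledMatrix, Matrix.of_apply]
  have h : (i ≠ j ∧ baseVertex i = baseVertex j) ↔ (j ≠ i ∧ baseVertex j = baseVertex i) := by
    rw [ne_comm, eq_comm (a := baseVertex i)]
  rw [hg, pairDot_comm]
  simp only [h]

theorem doubledMatrix_congr (g : V → V → R) {c c' : V → R × R} {U U' : Finset V} {i j : V ⊕ V}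
    (hi : layerVec c U i = layerVec c' U' i) (hj : layerVec c U j = layerVec c' U' j) :
    doubledMatrix g c U i j = doubledMatrix g c' U' i j := by
  simp only [doubledMatrix, Matrix.of_apply, hi, hj]

variable [Fintype V]

/-- The hafnian of the doubled graph with terminal set `T` and doubled vertices `U`. -/
noncomputable def doubledHaf (g : V → V → R) (c : V → R × R) (T U : Finset V) : R :=
  hafOn (doubledMatrix g c U) ((T ∪ U).disjSum U)

theorem Finset.disjSum_erase_inl {α β : Type*} [DecidableEq α] [DecidableEq β]
    (s : Finset α) (t : Finset β) (a : α) :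
    (s.disjSum t).erase (Sum.inl a) = (s.erase a).disjSum t := by
  ext (x | x) <;> simp

theorem Finset.disjSum_erase_inr {α β : Type*} [DecidableEq α] [DecidableEq β]
    (s : Finset α) (t : Finset β) (b : β) :
    (s.disjSum t).erase (Sum.inr b) = s.disjSum (t.erase b) := by
  ext (x | x) <;> simp

theorem doubledHaf_congr (g : V → V → R) {c c' : V → R × R} {T : Finset V} (U : Finset V)
    (h : ∀ t ∈ T, c t = c' t) : doubledHaf g c T U = doubledHaf g c' T U := by
  have key : ∀ i ∈ (T ∪ U).disjSum U, layerVec c U i = layerVec c' U i := by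
    rintro (v | v) hv
    · simp only [Finset.inl_mem_disjSum, Finset.mem_union] at hv
      simp only [layerVec]
      split_ifs with hvU
      · rfl
      · exact h v (hv.resolve_right hvU)
    · rfl
  exact hafOn_congr fun i hi j hj => doubledMatrix_congr g (key i hi) (key j hj)

/-- Expansion along a terminal `s`: either `s` is matched to another terminal, or the terminal moves
to a vertex `u` of `U`. -/
theorem doubledHaf_expand {g : V → V → R} (hg : ∀ u v, g u v = g v u)
    (c : V → R × R) {T U : Finset V} (hTU : Disjoint T U) {s : V} (hs : s ∈ T) :
    doubledHaf g c T U =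
      ∑ t ∈ T.erase s, g s t * pairDot (c s) (c t) * doubledHaf g c ((T.erase s).erase t) U +
      ∑ u ∈ U, g s u *
        doubledHaf g (Function.update c u (c s).swap) (insert u (T.erase s)) (U.erase u) := by
  have hsU : s ∉ U := Finset.disjoint_left.1 hTU hs
  have hM := doubledMatrix_symm hg c U
  have hE : (T ∪ U).erase s = T.erase s ∪ U := by
    rw [Finset.erase_union_distrib, Finset.erase_eq_of_notMem hsU]
  have hvs : layerVec c U (Sum.inl s) = c s := by simp [layerVec, hsU]
  unfold doubledHaf
  rw [hafOn_expand hM (i := Sum.inl s) (by simp [hs]), Finset.disjSum_erase_inl, Finset.sum_disjSum,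
    hE, Finset.sum_union (hTU.mono_left (Finset.erase_subset _ _)), add_assoc]
  congr 1
  · refine Finset.sum_congr rfl fun t ht => ?_
    have htU : t ∉ U := Finset.disjoint_left.1 hTU (Finset.mem_of_mem_erase ht)
    rw [Finset.disjSum_erase_inl, Finset.erase_union_distrib, Finset.erase_eq_of_notMem htU]
    congr 1
    simp [doubledMatrix, baseVertex, layerVec, hsU, htU]
  · rw [← Finset.sum_add_distrib]
    refine Finset.sum_congr rfl fun u hu => ?_
    have hus : s ≠ u := fun h => hsU (h ▸ hu)
    have huT : u ∉ T := Finset.disjoint_right.1 hTU hu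
    set W := (T.erase s ∪ U.erase u).disjSum (U.erase u) with hW
    have huT' : u ∉ T.erase s := fun h => huT (Finset.mem_of_mem_erase h)
    have e1 : ((T.erase s ∪ U).disjSum U).erase (Sum.inl u) =
        (T.erase s ∪ U.erase u).disjSum U := by
      rw [Finset.disjSum_erase_inl, Finset.erase_union_distrib, Finset.erase_eq_of_notMem huT']
    have e2 : ((insert u (T.erase s) ∪ U.erase u).disjSum (U.erase u)).erase (Sum.inl u) = W := by
      rw [Finset.disjSum_erase_inl, Finset.erase_union_distrib, Finset.erase_insert huT',
        Finset.erase_idem]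
    have e3 : ((T.erase s ∪ U).disjSum (U.erase u)).erase (Sum.inl u) = W := by
      rw [Finset.disjSum_erase_inl, Finset.erase_union_distrib, Finset.erase_eq_of_notMem huT']
    have hW1 : Sum.inl u ∉ W := by simp [hW, huT']
    have hW2 : Sum.inr u ∉ W := by simp [hW]
    have hvec : ∀ i ∈ W, layerVec c U i =
        layerVec (Function.update c u (c s).swap) (U.erase u) i := by
      rintro (v | v) hv
      · have : v ≠ u := by rintro rfl; exact hW1 hv
        simp [layerVec, this]
      · rfl
    rw [e1, hafOn_expand hM (i := Sum.inr u) (s := (T.erase s ∪ U.erase u).disjSum U)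
      (by simp [hu]), Finset.disjSum_erase_inr, Finset.disjSum_erase_inr,
      hafOn_expand hM (i := Sum.inl u) (s := (T.erase s ∪ U).disjSum (U.erase u)) (by simp [hu]),
      hafOn_expand (doubledMatrix_symm hg _ _) (i := Sum.inl u)
        (s := (insert u (T.erase s) ∪ U.erase u).disjSum (U.erase u)) (by simp), e2, e3,
      Finset.mul_sum, Finset.mul_sum, Finset.mul_sum, ← Finset.sum_add_distrib]
    refine Finset.sum_congr rfl fun j hj => ?_
    have hcongr : hafOn (doubledMatrix g (Function.update c u (c s).swap) (U.erase u)) (W.erase j) =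
        hafOn (doubledMatrix g c U) (W.erase j) :=
      hafOn_congr fun i hi k hk => (doubledMatrix_congr g (hvec i (Finset.mem_of_mem_erase hi))
        (hvec k (Finset.mem_of_mem_erase hk))).symm
    have hbj : u ≠ baseVertex j := by
      rintro rfl
      rcases j with v | v
      · exact hW1 hj
      · exact hW2 hj
    rw [hcongr]
    simp only [doubledMatrix, Matrix.of_apply, hvs, ← hvec j hj]
    simp [baseVertex, layerVec, hu, hus, pairDot] at hbj ⊢
    simp [hbj]
    ring

theorem doubledHaf_empty_terminals {g : V → V → R} (hg : ∀ u v, g u v = g v u) {x : R}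
    (hx : ∀ u v, x ∣ g u v) (c : V → R × R) (U : Finset V) :
    ∃ f, doubledHaf g c ∅ U = 1 + x * f := by
  induction U using Finset.induction_on generalizing c with
  | empty => exact ⟨0, by simp [doubledHaf, hafOn_empty]⟩
  | insert u U hu ih =>
    obtain ⟨f, hf⟩ := ih c
    suffices h : x ∣ doubledHaf g c ∅ (insert u U) - doubledHaf g c ∅ U by
      obtain ⟨k, hk⟩ := h
      exact ⟨f + k, by linear_combination hk + hf⟩
    have hM := doubledMatrix_symm hg c (insert u U)
    have e : ((insert u U).disjSum (insert u U)).erase (Sum.inl u) = U.disjSum (insert u U) := by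
      rw [Finset.disjSum_erase_inl, Finset.erase_insert hu]
    have h1 : doubledHaf g c ∅ U =
        hafOn (doubledMatrix g c (insert u U)) (U.disjSum U) := by
      unfold doubledHaf
      rw [Finset.empty_union]
      have hv : ∀ i ∈ U.disjSum U, layerVec c U i = layerVec c (insert u U) i := by
        rintro (v | v) hv
        · simp only [Finset.inl_mem_disjSum] at hv
          simp [layerVec, hv]
        · rfl
      exact hafOn_congr fun i hi j hj => doubledMatrix_congr g (hv i hi) (hv j hj)
    unfold doubledHaf at h1 ⊢
    rw [h1, Finset.empty_union, hafOn_expand hM (i := Sum.inl u) (by simp), e,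
      ← Finset.add_sum_erase _ _ (show Sum.inr u ∈ U.disjSum (insert u U) by simp),
      Finset.disjSum_erase_inr, Finset.erase_insert hu, add_sub_right_comm]
    refine dvd_add ?_ (Finset.dvd_sum fun j hj => Dvd.dvd.mul_right ?_ _)
    · rw [← sub_one_mul]
      refine Dvd.dvd.mul_right ?_ _
      simpa [doubledMatrix, baseVertex] using (hx u u).mul_right _
    · have hbj : u ≠ baseVertex j := by
        rintro rfl
        rcases j with v | v <;> simp at hj <;> exact hu hj
      simp only [doubledMatrix, Matrix.of_apply]
      rw [if_neg (fun h => hbj h.2), add_zero]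
      exact (hx _ _).mul_right _

end Doubled

section Paths

variable {V : Type*} [Fintype V] [LinearOrder V] {G : SimpleGraph V} [DecidableRel G.Adj]
  {R : Type*} [CommRing R]

/-- The weight of an edge as a power of `x`, and zero for non-adjacent vertices. -/
def edgePow (G : SimpleGraph V) [DecidableRel G.Adj] (w : Sym2 V → ℕ) (x : R) (u v : V) : R :=
  if G.Adj u v then x ^ w s(u, v) else 0

omit [Fintype V] [LinearOrder V] in
theorem edgePow_symm (w : Sym2 V → ℕ) (x : R) (u v : V) :
    edgePow G w x u v = edgePow G w x v u := by
  simp only [edgePow, G.adj_comm u v, Sym2.eq_swap (a := u)]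

/-- The total edge weight of a path. -/
def PathSig.weight (w : Sym2 V → ℕ) (p : PathSig G) : ℕ := (p.2.2.1.edges.map w).sum

/-- The contribution of a path to the hafnian of the doubled graph. -/
def PathSig.term (w : Sym2 V → ℕ) (x : R) (c : V → R × R) (p : PathSig G) : R :=
  pairDot (if Even p.2.2.1.length then (c p.1).swap else c p.1) (c p.2.1) * x ^ PathSig.weight w p

/-- The paths from `s` to another vertex of `T` all of whose inner vertices are in `U`. -/
noncomputable def pathsFrom (G : SimpleGraph V) [DecidableRel G.Adj] (s : V) (T U : Finset V) :
    Finset (PathSig G) :=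
  Finset.univ.filter fun p => p.1 = s ∧ p.2.1 ∈ T.erase s ∧
    ∀ v ∈ p.2.2.1.support, v = p.1 ∨ v = p.2.1 ∨ v ∈ U

/-- The paths that arise from those of `pathsFrom G s T U` by removing the first vertex. -/
noncomputable def tailsFrom (G : SimpleGraph V) [DecidableRel G.Adj] (s : V) (T U : Finset V) :
    Finset (PathSig G) :=
  Finset.univ.filter fun q => G.Adj s q.1 ∧ s ∉ q.2.2.1.support ∧ q.2.1 ∈ T.erase s ∧
    ∀ v ∈ q.2.2.1.support, v = q.2.1 ∨ v ∈ U

theorem sum_pathsFrom_eq_sum_tailsFrom {s : V} {T U : Finset V} (F H : PathSig G → R)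
    (hFH : ∀ (q : PathSig G) (h : G.Adj s q.1) (hs : s ∉ q.2.2.1.support),
      F ⟨s, q.2.1, ⟨SimpleGraph.Walk.cons h q.2.2.1, q.2.2.2.cons hs⟩⟩ = H q) :
    ∑ p ∈ pathsFrom G s T U, F p = ∑ q ∈ tailsFrom G s T U, H q := by
  symm
  refine Finset.sum_bij (fun q hq => ⟨s, q.2.1, ⟨SimpleGraph.Walk.cons
    (Finset.mem_filter.1 hq).2.1 q.2.2.1, q.2.2.2.cons (Finset.mem_filter.1 hq).2.2.1⟩⟩) ?_ ?_ ?_ ?_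
  · intro q hq
    simp only [tailsFrom, pathsFrom, Finset.mem_filter, Finset.mem_univ, true_and,
      SimpleGraph.Walk.support_cons, List.mem_cons] at hq ⊢
    refine ⟨hq.2.2.1, ?_⟩
    rintro v (hv | hv)
    · exact Or.inl hv
    · exact Or.inr (hq.2.2.2 v hv)
  · rintro ⟨a, b, p, hp⟩ h1 ⟨a₂, b₂, p₂, hp₂⟩ h2 h
    simp only [Sigma.mk.injEq, heq_eq_eq, true_and] at h
    obtain ⟨rfl, h⟩ := h
    simp only [heq_eq_eq, Subtype.mk.injEq, SimpleGraph.Walk.cons.injEq] at h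
    obtain ⟨rfl, h⟩ := h
    simp only [heq_eq_eq] at h
    subst h
    rfl
  · rintro ⟨a, b, p, hp⟩ h
    simp only [pathsFrom, Finset.mem_filter, Finset.mem_univ, true_and] at h
    obtain ⟨rfl, hb, hU⟩ := h
    cases p with
    | nil => simp at hb
    | @cons _ v _ hadj p =>
      have hp2 := (SimpleGraph.Walk.cons_isPath_iff _ _).1 hp
      refine ⟨⟨v, b, p, hp2.1⟩, ?_, rfl⟩
      simp only [tailsFrom, Finset.mem_filter, Finset.mem_univ, true_and]
      refine ⟨hadj, hp2.2, hb, fun v hv => ?_⟩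
      rcases hU v (by simp [hv]) with rfl | h
      · exact absurd hv hp2.2
      · exact h
  · intro q hq
    exact (hFH q (Finset.mem_filter.1 hq).2.1 (Finset.mem_filter.1 hq).2.2.1).symm

/-- Expansion of the hafnian of the doubled graph along the path starting at a terminal `s`. -/
theorem doubledHaf_eq_sum_pathsFrom (w : Sym2 V → ℕ) (x : R) (c : V → R × R) {T U : Finset V}
    (hTU : Disjoint T U) {s : V} (hs : s ∈ T) :
    doubledHaf (edgePow G w x) c T U = ∑ p ∈ pathsFrom G s T U, PathSig.term w x c p *
      doubledHaf (edgePow G w x) c ((T.erase s).erase p.2.1) (U \ p.2.2.1.support.toFinset) := by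
  induction U using Finset.strongInduction generalizing c T s with
  | H U ih =>
  have hsU : s ∉ U := Finset.disjoint_left.1 hTU hs
  rw [sum_pathsFrom_eq_sum_tailsFrom _ (fun q => edgePow G w x s q.1 *
    (pairDot (if Even q.2.2.1.length then c s else (c s).swap) (c q.2.1) *
      x ^ PathSig.weight w q *
      doubledHaf (edgePow G w x) c ((T.erase s).erase q.2.1) (U \ q.2.2.1.support.toFinset)))]
  swap
  · intro q h hqs
    have e1 : U \ (insert s q.2.2.1.support.toFinset) = U \ q.2.2.1.support.toFinset := by
      rw [Finset.sdiff_insert, Finset.erase_eq_of_notMem (by simp [hsU])]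
    simp only [PathSig.term, PathSig.weight, SimpleGraph.Walk.length_cons, Nat.even_add_one,
      SimpleGraph.Walk.edges_cons, List.map_cons, List.sum_cons, pow_add, edgePow, if_pos h,
      SimpleGraph.Walk.support_cons, List.toFinset_cons, e1, ite_not]
    ring
  rw [doubledHaf_expand (edgePow_symm w x) c hTU hs,
    ← Finset.sum_fiberwise_of_maps_to (s := tailsFrom G s T U) (t := T.erase s ∪ U)
      (g := fun q => q.1), Finset.sum_union (hTU.mono_left (Finset.erase_subset _ _))]
  swap
  · intro q hq
    simp only [tailsFrom, Finset.mem_filter, Finset.mem_univ, true_and] at hq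
    rw [Finset.mem_union]
    rcases hq.2.2.2 q.1 (by simp) with h | h
    · exact Or.inl (h ▸ hq.2.2.1)
    · exact Or.inr h
  congr 1
  · refine Finset.sum_congr rfl fun t ht => ?_
    by_cases hadj : G.Adj s t
    · have e : (tailsFrom G s T U).filter (fun q => q.1 = t) =
          {⟨t, t, ⟨SimpleGraph.Walk.nil, SimpleGraph.Walk.IsPath.nil⟩⟩} := by
        ext ⟨a, b, p, hp⟩
        simp only [tailsFrom, Finset.mem_filter, Finset.mem_univ, true_and, Finset.mem_singleton]
        constructor
        · rintro ⟨⟨h1, h2, h3, h4⟩, rfl⟩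
          rcases h4 a (by simp) with rfl | h
          · cases (SimpleGraph.Walk.isPath_iff_nil.1 hp).eq_nil
            rfl
          · exact absurd h (Finset.disjoint_left.1 hTU (Finset.mem_of_mem_erase ht))
        · intro h
          cases h
          refine ⟨⟨hadj, ?_, ht, ?_⟩, rfl⟩
          · simpa using hadj.ne
          · simp
      have htU : t ∉ U := Finset.disjoint_left.1 hTU (Finset.mem_of_mem_erase ht)
      rw [e, Finset.sum_singleton]
      simp [PathSig.weight, Finset.sdiff_singleton_eq_erase, htU, mul_assoc]
    · rw [Finset.sum_eq_zero]
      · simp [edgePow, hadj]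
      · intro q hq
        simp only [tailsFrom, Finset.mem_filter, Finset.mem_univ, true_and] at hq
        exact absurd (hq.2 ▸ hq.1.1) hadj
  · refine Finset.sum_congr rfl fun u hu => ?_
    have hus : s ≠ u := fun h => hsU (h ▸ hu)
    have huT : u ∉ T := Finset.disjoint_right.1 hTU hu
    have huT' : u ∉ T.erase s := fun h => huT (Finset.mem_of_mem_erase h)
    by_cases hadj : G.Adj s u
    · have e : (tailsFrom G s T U).filter (fun q => q.1 = u) =
          pathsFrom G u (insert u (T.erase s)) (U.erase u) := by
        ext ⟨a, b, p, hp⟩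
        simp only [tailsFrom, pathsFrom, Finset.mem_filter, Finset.mem_univ, true_and,
          Finset.erase_insert huT']
        constructor
        · rintro ⟨⟨h1, h2, h3, h4⟩, rfl⟩
          refine ⟨rfl, h3, fun v hv => ?_⟩
          rcases h4 v hv with h | h
          · exact Or.inr (Or.inl h)
          · by_cases hva : v = a
            · exact Or.inl hva
            · exact Or.inr (Or.inr (Finset.mem_erase.2 ⟨hva, h⟩))
        · rintro ⟨rfl, h3, h4⟩
          refine ⟨⟨hadj, fun hsp => ?_, h3, fun v hv => ?_⟩, rfl⟩
          · rcases h4 s hsp with h | rfl | h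
            · exact hus h
            · simp at h3
            · exact hsU (Finset.mem_of_mem_erase h)
          · rcases h4 v hv with rfl | h | h
            · exact Or.inr hu
            · exact Or.inl h
            · exact Or.inr (Finset.mem_of_mem_erase h)
      have hdisj : Disjoint (insert u (T.erase s)) (U.erase u) := by
        rw [Finset.disjoint_insert_left]
        exact ⟨by simp, hTU.mono (Finset.erase_subset _ _) (Finset.erase_subset _ _)⟩
      rw [e, ih (U.erase u) (Finset.erase_ssubset hu) (Function.update c u (c s).swap) hdisj
        (Finset.mem_insert_self _ _), Finset.mul_sum]
      refine Finset.sum_congr rfl fun q hq => ?_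
      simp only [pathsFrom, Finset.mem_filter, Finset.mem_univ, true_and,
        Finset.erase_insert huT'] at hq
      obtain ⟨hq1, hq2, hq3⟩ := hq
      have hq4 : q.2.1 ≠ u := fun h => huT' (h ▸ hq2)
      have e1 : U.erase u \ q.2.2.1.support.toFinset = U \ q.2.2.1.support.toFinset := by
        ext v
        simp only [Finset.mem_sdiff, Finset.mem_erase, List.mem_toFinset]
        constructor
        · exact fun h => ⟨h.1.2, h.2⟩
        · refine fun h => ⟨⟨?_, h.1⟩, h.2⟩
          rintro rfl
          exact h.2 (hq1 ▸ q.2.2.1.start_mem_support)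
      have e2 : edgePow G w x s q.1 = edgePow G w x s u := by rw [hq1]
      rw [Finset.erase_insert huT', e1, e2,
        doubledHaf_congr (c := Function.update c u (c s).swap) (c' := c)]
      · simp only [PathSig.term, hq1, Function.update_self, Function.update_of_ne hq4,
          Prod.swap_swap]
      · intro t ht
        refine Function.update_of_ne ?_ _ _
        rintro rfl
        exact huT' (Finset.mem_of_mem_erase ht)
    · rw [Finset.sum_eq_zero]
      · simp [edgePow, hadj]
      · intro q hq
        simp only [tailsFrom, Finset.mem_filter, Finset.mem_univ, true_and] at hq
        exact absurd (hq.2 ▸ hq.1.1) hadj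


/-- The set of vertices of a path. -/
def PathSig.vertices (p : PathSig G) : Finset V := p.2.2.1.support.toFinset

omit [Fintype V] [DecidableRel G.Adj] in
theorem PathSig.start_mem_vertices (p : PathSig G) : p.1 ∈ p.vertices := by
  simp [PathSig.vertices]

omit [Fintype V] [DecidableRel G.Adj] in
theorem PathSig.end_mem_vertices (p : PathSig G) : p.2.1 ∈ p.vertices := by
  simp [PathSig.vertices]

/-- A set of disjoint paths that join the vertices of `T` in pairs and whose inner vertices are
in `U`. -/
def IsPairing (T U : Finset V) (P : Finset (PathSig G)) : Prop :=
  (∀ p ∈ P, p.1 < p.2.1) ∧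
  (∀ p ∈ P, p.1 ∈ T ∧ p.2.1 ∈ T) ∧
  (∀ p ∈ P, ∀ v ∈ p.vertices, v = p.1 ∨ v = p.2.1 ∨ v ∈ U) ∧
  (∀ p ∈ P, ∀ q ∈ P, p ≠ q → ∀ v ∈ p.vertices, v ∉ q.vertices) ∧
  ∀ t ∈ T, ∃ p ∈ P, t = p.1 ∨ t = p.2.1

theorem mem_pathsFrom {s : V} {T U : Finset V} {p : PathSig G} :
    p ∈ pathsFrom G s T U ↔ p.1 = s ∧ p.2.1 ∈ T.erase s ∧
      ∀ v ∈ p.vertices, v = p.1 ∨ v = p.2.1 ∨ v ∈ U := by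
  simp [pathsFrom, PathSig.vertices]

omit [Fintype V] [DecidableRel G.Adj] in
theorem IsPairing.erase {T U : Finset V} {P : Finset (PathSig G)} (h : IsPairing T U P)
    {p : PathSig G} (hp : p ∈ P) :
    IsPairing ((T.erase p.1).erase p.2.1) (U \ p.vertices) (P.erase p) := by
  obtain ⟨h1, h2, h3, h4, h5⟩ := h
  have key : ∀ q ∈ P.erase p, ∀ v ∈ q.vertices, v ∉ p.vertices := fun q hq =>
    h4 q (Finset.mem_of_mem_erase hq) p hp (Finset.ne_of_mem_erase hq)
  have hmem : ∀ q ∈ P.erase p, ∀ v ∈ q.vertices, v ∈ T → v ∈ (T.erase p.1).erase p.2.1 := by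
    intro q hq v hv hvT
    refine Finset.mem_erase.2 ⟨?_, Finset.mem_erase.2 ⟨?_, hvT⟩⟩
    · rintro rfl
      exact key q hq _ hv p.end_mem_vertices
    · rintro rfl
      exact key q hq _ hv p.start_mem_vertices
  refine ⟨fun q hq => h1 q (Finset.mem_of_mem_erase hq), fun q hq => ?_, fun q hq v hv => ?_,
    fun q hq r hr => h4 q (Finset.mem_of_mem_erase hq) r (Finset.mem_of_mem_erase hr),
    fun t ht => ?_⟩
  · have := h2 q (Finset.mem_of_mem_erase hq)
    exact ⟨hmem q hq _ q.start_mem_vertices this.1, hmem q hq _ q.end_mem_vertices this.2⟩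
  · rcases h3 q (Finset.mem_of_mem_erase hq) v hv with h | h | h
    · exact Or.inl h
    · exact Or.inr (Or.inl h)
    · exact Or.inr (Or.inr (Finset.mem_sdiff.2 ⟨h, key q hq v hv⟩))
  · simp only [Finset.mem_erase] at ht
    obtain ⟨q, hq, hqt⟩ := h5 t ht.2.2
    refine ⟨q, Finset.mem_erase.2 ⟨?_, hq⟩, hqt⟩
    rintro rfl
    exact hqt.elim ht.2.1 ht.1

omit [Fintype V] [DecidableRel G.Adj] in
theorem IsPairing.insert {T U : Finset V} (hTU : Disjoint T U) {p : PathSig G}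
    (hlt : p.1 < p.2.1) (hp1 : p.1 ∈ T) (hp2 : p.2.1 ∈ T)
    (hp : ∀ v ∈ p.vertices, v = p.1 ∨ v = p.2.1 ∨ v ∈ U) {P : Finset (PathSig G)}
    (h : IsPairing ((T.erase p.1).erase p.2.1) (U \ p.vertices) P) :
    IsPairing T U (Insert.insert p P) := by
  obtain ⟨h1, h2, h3, h4, h5⟩ := h
  have hT : ∀ v ∈ (T.erase p.1).erase p.2.1, v ∉ p.vertices := by
    intro v hv hvp
    simp only [Finset.mem_erase] at hv
    rcases hp v hvp with h | h | h
    · exact hv.2.1 h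
    · exact hv.1 h
    · exact Finset.disjoint_left.1 hTU hv.2.2 h
  have key : ∀ q ∈ P, ∀ v ∈ q.vertices, v ∉ p.vertices := by
    intro q hq v hv
    rcases h3 q hq v hv with rfl | rfl | h
    · exact hT _ (h2 q hq).1
    · exact hT _ (h2 q hq).2
    · exact (Finset.mem_sdiff.1 h).2
  refine ⟨?_, ?_, ?_, ?_, ?_⟩
  · exact Finset.forall_mem_insert .. |>.2 ⟨hlt, h1⟩
  · refine Finset.forall_mem_insert .. |>.2 ⟨⟨hp1, hp2⟩, fun q hq => ?_⟩
    have := h2 q hq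
    simp only [Finset.mem_erase] at this
    exact ⟨this.1.2.2, this.2.2.2⟩
  · refine Finset.forall_mem_insert .. |>.2 ⟨hp, fun q hq v hv => ?_⟩
    exact (h3 q hq v hv).imp id (Or.imp id fun h => (Finset.mem_sdiff.1 h).1)
  · intro q hq r hr hqr v hvq hvr
    rcases Finset.mem_insert.1 hq with rfl | hqP <;> rcases Finset.mem_insert.1 hr with rfl | hrP
    · exact hqr rfl
    · exact key r hrP v hvr hvq
    · exact key q hqP v hvq hvr
    · exact h4 q hqP r hrP hqr v hvq hvr
  · intro t ht
    by_cases htp : t = p.1 ∨ t = p.2.1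
    · exact ⟨p, Finset.mem_insert_self _ _, htp⟩
    · rw [not_or] at htp
      obtain ⟨q, hq, hqt⟩ := h5 t (by simp [htp, ht])
      exact ⟨q, Finset.mem_insert_of_mem hq, hqt⟩

/-- The hafnian of the doubled graph as a sum over the pairings of the terminals by disjoint
paths. -/
theorem doubledHaf_eq_sum_isPairing (w : Sym2 V → ℕ) (x : R) (c : V → R × R) {T U : Finset V}
    (hTU : Disjoint T U) :
    doubledHaf (edgePow G w x) c T U =
      ∑ P ∈ Finset.univ.filter (fun P : Finset (PathSig G) => IsPairing T U P),
        (∏ p ∈ P, PathSig.term w x c p) *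
          doubledHaf (edgePow G w x) c ∅ (U \ P.biUnion PathSig.vertices) := by
  induction T using Finset.strongInduction generalizing U with
  | H T ih =>
  rcases T.eq_empty_or_nonempty with rfl | hT
  · have e : Finset.univ.filter (fun P : Finset (PathSig G) => IsPairing ∅ U P) = {∅} := by
      ext P
      simp only [Finset.mem_filter, Finset.mem_univ, true_and, Finset.mem_singleton]
      constructor
      · intro h
        refine Finset.eq_empty_of_forall_notMem fun p hp => ?_
        simpa using (h.2.1 p hp).1
      · rintro rfl
        simp [IsPairing]
    simp [e]
  · set s := T.min' hT with hsdef
    have hs : s ∈ T := T.min'_mem hT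
    set K := Finset.univ.filter (fun P : Finset (PathSig G) => IsPairing T U P) with hK
    set f : Finset (PathSig G) → R := fun P => (∏ p ∈ P, PathSig.term w x c p) *
      doubledHaf (edgePow G w x) c ∅ (U \ P.biUnion PathSig.vertices) with hf
    have hlt : ∀ p ∈ pathsFrom G s T U, p.1 < p.2.1 := by
      intro p hp
      obtain ⟨hp1, hp2, -⟩ := mem_pathsFrom.1 hp
      exact hp1.trans_lt (T.min'_lt_of_mem_erase_min' hT hp2)
    have hsum : ∑ P ∈ K, f P = ∑ p ∈ pathsFrom G s T U, ∑ P ∈ K.filter (fun P => p ∈ P), f P := by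
      rw [Finset.sum_comm' (t' := K) (s' := fun P => (pathsFrom G s T U).filter (fun p => p ∈ P))
        (by simp; tauto)]
      refine Finset.sum_congr rfl fun P hP => ?_
      simp only [hK, Finset.mem_filter, Finset.mem_univ, true_and] at hP
      obtain ⟨h1, h2, h3, h4, h5⟩ := hP
      obtain ⟨p, hpP, hp⟩ := h5 s hs
      have hps : s = p.1 := by
        refine hp.resolve_right fun h => ?_
        exact (T.min'_le _ (h2 p hpP).1).not_gt (by rw [← hsdef, h]; exact h1 p hpP)
      have e : (pathsFrom G s T U).filter (fun p => p ∈ P) = {p} := by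
        ext q
        simp only [Finset.mem_filter, Finset.mem_singleton, mem_pathsFrom]
        constructor
        · rintro ⟨⟨hq, -⟩, hqP⟩
          by_contra hqp
          refine h4 q hqP p hpP hqp s ?_ ?_
          · rw [← hq]; exact q.start_mem_vertices
          · rw [hps]; exact p.start_mem_vertices
        · rintro rfl
          refine ⟨⟨hps.symm, Finset.mem_erase.2 ⟨?_, (h2 q hpP).2⟩, h3 q hpP⟩, hpP⟩
          rw [hps]
          exact (h1 q hpP).ne'
      rw [e, Finset.sum_singleton]
    rw [hsum, doubledHaf_eq_sum_pathsFrom w x c hTU hs]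
    refine Finset.sum_congr rfl fun p hp => ?_
    have hplt := hlt p hp
    obtain ⟨hp1, hp2, hp3⟩ := mem_pathsFrom.1 hp
    have hp2T := Finset.mem_of_mem_erase hp2
    have hTs : T.erase p.1 = T.erase s := by rw [hp1]
    have hss : (T.erase s).erase p.2.1 ⊂ T :=
      (Finset.erase_subset _ _).trans_ssubset (Finset.erase_ssubset hs)
    rw [ih _ hss (hTU.mono hss.subset Finset.sdiff_subset), Finset.mul_sum]
    symm
    have hnot : ∀ P : Finset (PathSig G), IsPairing ((T.erase s).erase p.2.1) (U \ p.vertices) P →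
        p ∉ P := by
      intro P hP hpP
      simpa using (hP.2.1 p hpP).2
    refine Finset.sum_bij' (fun P _ => P.erase p) (fun P _ => insert p P) ?_ ?_ ?_ ?_ ?_
    · intro P hP
      simp only [hK, Finset.mem_filter, Finset.mem_univ, true_and] at hP ⊢
      rw [← hTs]
      exact hP.1.erase hP.2
    · intro P hP
      simp only [hK, Finset.mem_filter, Finset.mem_univ, true_and] at hP ⊢
      refine ⟨IsPairing.insert hTU hplt (hp1 ▸ hs) hp2T hp3 ?_, Finset.mem_insert_self _ _⟩
      rwa [hTs]
    · intro P hP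
      exact Finset.insert_erase (Finset.mem_filter.1 hP).2
    · intro P hP
      exact Finset.erase_insert (hnot P (Finset.mem_filter.1 hP).2)
    · intro P hP
      have hpP := (Finset.mem_filter.1 hP).2
      have e : U \ P.biUnion PathSig.vertices =
          (U \ p.2.2.1.support.toFinset) \ (P.erase p).biUnion PathSig.vertices := by
        conv_lhs => rw [← Finset.insert_erase hpP, Finset.biUnion_insert]
        exact sdiff_sdiff_left.symm
      simp only [hf]
      rw [e, ← Finset.mul_prod_erase P _ hpP, mul_assoc]


omit [Fintype V] [DecidableRel G.Adj] in
theorem card_biUnion_ends {P : Finset (PathSig G)} (hlt : ∀ p ∈ P, p.1 < p.2.1)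
    (hdisj : ∀ p ∈ P, ∀ q ∈ P, p ≠ q → ∀ v ∈ p.vertices, v ∉ q.vertices) :
    (P.biUnion fun p => {p.1, p.2.1}).card = 2 * P.card := by
  have hsub : ∀ p : PathSig G, ({p.1, p.2.1} : Finset V) ⊆ p.vertices := by
    intro p v hv
    rcases Finset.mem_insert.1 hv with rfl | hv
    · exact p.start_mem_vertices
    · rw [Finset.mem_singleton.1 hv]
      exact p.end_mem_vertices
  rw [Finset.card_biUnion, Finset.sum_congr rfl fun p hp => Finset.card_pair (hlt p hp).ne]
  · simp [mul_comm]
  · intro p hp q hq hpq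
    exact Finset.disjoint_left.2 fun v hv hv' => hdisj p hp q hq hpq v (hsub p hv) (hsub q hv')

omit [DecidableRel G.Adj] in
theorem isPerfectABPacking_iff {A B : Finset V} (hAB : Disjoint A B) (hA : Even A.card)
    (hB : Even B.card) (P : Finset (PathSig G)) :
    IsPerfectABPacking G A B P ↔
      IsPairing (A ∪ B) (Finset.univ.filter fun v => v ∉ A ∧ v ∉ B) P ∧
        ∀ p ∈ P, (p.1 ∈ A ∧ p.2.1 ∈ A) ∨ (p.1 ∈ B ∧ p.2.1 ∈ B) := by
  have hcard : (A ∪ B).card = A.card + B.card := Finset.card_union_of_disjoint hAB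
  obtain ⟨a, ha⟩ := hA
  obtain ⟨b, hb⟩ := hB
  constructor
  · rintro ⟨h1, h2, h3, h4⟩
    have h3' : ∀ p ∈ P, ∀ q ∈ P, p ≠ q → ∀ v ∈ p.vertices, v ∉ q.vertices := by
      simpa only [PathSig.vertices, List.mem_toFinset] using h3
    have hends : ∀ p ∈ P, p.1 ∈ A ∪ B ∧ p.2.1 ∈ A ∪ B := by
      intro p hp
      simp only [Finset.mem_union]
      have := h2 p hp
      tauto
    have hcover : (P.biUnion fun p => {p.1, p.2.1}) = A ∪ B := by
      refine Finset.eq_of_subset_of_card_le ?_ ?_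
      · refine Finset.biUnion_subset.2 fun p hp v hv => ?_
        rcases Finset.mem_insert.1 hv with rfl | hv
        · exact (hends p hp).1
        · exact Finset.mem_singleton.1 hv ▸ (hends p hp).2
      · rw [card_biUnion_ends h1 h3']
        omega
    have hcover' : ∀ t ∈ A ∪ B, ∃ p ∈ P, t = p.1 ∨ t = p.2.1 := by
      intro t ht
      rw [← hcover] at ht
      simpa using ht
    refine ⟨⟨h1, hends, fun p hp v hv => ?_, h3', hcover'⟩, h2⟩
    by_cases hvT : v ∈ A ∪ B
    · obtain ⟨q, hq, hqv⟩ := hcover' v hvT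
      by_cases hpq : p = q
      · subst hpq
        exact hqv.imp id Or.inl
      · refine absurd ?_ (h3' p hp q hq hpq v hv)
        rcases hqv with rfl | rfl
        · exact q.start_mem_vertices
        · exact q.end_mem_vertices
    · exact Or.inr (Or.inr (by simpa using hvT))
  · rintro ⟨⟨h1, h2, h3, h4, h5⟩, h6⟩
    have h4' : ∀ p ∈ P, ∀ q ∈ P, p ≠ q →
        ∀ v : V, v ∈ p.2.2.1.support → v ∉ q.2.2.1.support := by
      simpa only [PathSig.vertices, List.mem_toFinset] using h4
    refine ⟨h1, h6, h4', ?_⟩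
    have hcover : (P.biUnion fun p => {p.1, p.2.1}) = A ∪ B := by
      ext v
      constructor
      · intro hv
        simp only [Finset.mem_biUnion, Finset.mem_insert, Finset.mem_singleton] at hv
        obtain ⟨p, hp, rfl | rfl⟩ := hv
        · exact (h2 p hp).1
        · exact (h2 p hp).2
      · intro hv
        simpa using h5 v hv
    have := card_biUnion_ends h1 h4
    rw [hcover] at this
    omega

/-- The vector `(1, 1)` for the terminals in `A` and `(1, -1)` for the terminals in `B`. -/
noncomputable def terminalVec (B : Finset V) (v : V) : Polynomial ℤ × Polynomial ℤ :=
  if v ∈ B then (1, -1) else (1, 1)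

theorem haf_gallaiSP_eq_doubledHaf (w : Sym2 V → ℕ) (A B : Finset V)
    (hnoedge : ∀ u v : V, G.Adj u v → ¬(u ∈ A ∪ B ∧ v ∈ A ∪ B)) :
    haf (gallaiSP G w A B) = doubledHaf (edgePow G w Polynomial.X) (terminalVec B) (A ∪ B)
      (Finset.univ.filter fun v => v ∉ A ∧ v ∉ B) := by
  set U := Finset.univ.filter fun v => v ∉ A ∧ v ∉ B with hU
  have hmU : ∀ v, v ∈ U ↔ v ∉ A ∧ v ∉ B := by simp [hU]
  let e : GallaiVertex A B ↪ V ⊕ V :=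
    Function.Embedding.sumMap (Function.Embedding.refl V) (Function.Embedding.subtype _)
  have hM := doubledMatrix_symm (edgePow_symm (G := G) w Polynomial.X) (terminalVec B) U
  have huniv : Finset.univ.map e = (A ∪ B ∪ U).disjSum U := by
    ext (v | v)
    · simp [e, hmU]
      tauto
    · simp [e, hmU]
  have hlr : ∀ (u : V) (v : {v : V // v ∉ A ∧ v ∉ B}), gallaiSP G w A B (Sum.inl u) (Sum.inr v) =
      doubledMatrix (edgePow G w Polynomial.X) (terminalVec B) U (Sum.inl u) (Sum.inr v.1) := by
    rintro u ⟨v, hv⟩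
    by_cases huv : u = v
    · subst huv
      simp [gallaiSP, doubledMatrix, baseVertex, edgePow]
    · by_cases huT : u ∈ A ∪ B
      · have huU : u ∉ U := by
          rw [hmU]
          rw [Finset.mem_union] at huT
          tauto
        by_cases huB : u ∈ B <;> by_cases hadj : G.Adj u v <;>
          simp [gallaiSP, doubledMatrix, baseVertex, edgePow, huv, layerVec, huU, pairDot,
            terminalVec, huB, hadj]
        exact fun h => absurd ((Finset.mem_union.1 huT).resolve_right huB) h
      · have huU : u ∈ U := by
          rw [hmU]
          simpa using huT
        have huAB := (hmU u).1 huU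
        simp [gallaiSP, doubledMatrix, baseVertex, layerVec, huU, pairDot, huv, huAB]
  have hent : ∀ i j, gallaiSP G w A B i j =
      doubledMatrix (edgePow G w Polynomial.X) (terminalVec B) U (e i) (e j) := by
    rintro (u | u) (v | v)
    · by_cases hadj : G.Adj u v
      · have := hnoedge u v hadj
        have hne := hadj.ne
        by_cases hu : u ∈ U <;> by_cases hv : v ∈ U
        · simp [gallaiSP, doubledMatrix, baseVertex, edgePow, layerVec, pairDot, hadj, hu, hv, e,
            hne]
        · by_cases hvB : v ∈ B <;>
            simp [gallaiSP, doubledMatrix, baseVertex, edgePow, layerVec, pairDot, hadj, hu, hv, e,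
              hne, terminalVec, hvB]
        · by_cases huB : u ∈ B <;>
            simp [gallaiSP, doubledMatrix, baseVertex, edgePow, layerVec, pairDot, hadj, hu, hv, e,
              hne, terminalVec, huB]
        · rw [hmU] at hu hv
          simp only [Finset.mem_union] at this
          tauto
      · simp [gallaiSP, doubledMatrix, baseVertex, edgePow, hadj, e]
    · exact hlr u v
    · have h : gallaiSP G w A B (Sum.inr u) (Sum.inl v) =
          gallaiSP G w A B (Sum.inl v) (Sum.inr u) := rfl
      rw [h, hlr, hM]
      rfl
    · simp [gallaiSP, doubledMatrix, baseVertex, edgePow, layerVec, pairDot, e]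
      rfl
  rw [haf_eq_hafOn_univ, hafOn_map e hM hent, huniv]
  rfl

omit [Fintype V] [DecidableRel G.Adj] in
theorem prod_term_eq {w : Sym2 V → ℕ} {A B : Finset V} (hAB : Disjoint A B)
    {P : Finset (PathSig G)}
    (hP : ∀ p ∈ P, (p.1 ∈ A ∧ p.2.1 ∈ A) ∨ (p.1 ∈ B ∧ p.2.1 ∈ B)) :
    ∏ p ∈ P, PathSig.term w Polynomial.X (terminalVec B) p =
      (-1) ^ thetaB B P * 2 ^ P.card * Polynomial.X ^ packingWeight w P := by
  have h : ∀ p ∈ P, PathSig.term w Polynomial.X (terminalVec B) p =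
      (if p.1 ∈ B ∧ p.2.1 ∈ B ∧ Even p.2.2.1.length then -1 else 1) * 2 *
        Polynomial.X ^ PathSig.weight w p := by
    intro p hp
    rw [PathSig.term]
    congr 1
    rcases hP p hp with ⟨h1, h2⟩ | ⟨h1, h2⟩
    · have h1' := Finset.disjoint_left.1 hAB h1
      have h2' := Finset.disjoint_left.1 hAB h2
      simp only [terminalVec, h1', h2', pairDot]
      norm_num
    · by_cases he : Even p.2.2.1.length <;> simp [terminalVec, h1, h2, he, pairDot] <;> norm_num
  rw [Finset.prod_congr rfl h, Finset.prod_mul_distrib, Finset.prod_mul_distrib,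
    ← Finset.prod_filter, Finset.prod_const, Finset.prod_const, Finset.prod_pow_eq_pow_sum]
  rfl

end Paths

/-- Under the hypotheses of the Gallai construction (disjoint
terminal sets `A, B` of even cardinality, no edge of `G` with both endpoints in
`A ∪ B`, positive integral edge weights), with `τ = (|A|+|B|)/2`:
`haf S' = Σ_𝓟 (−1)^{θ(𝓟)} · 2^τ · x^{w(𝓟)} · (1 + x·f_𝓟(x))`, where `𝓟` ranges
over all perfect `(A+B)`-path packings of `G` and each `f_𝓟` is some integer
polynomial. -/
theorem haf_gallaiSP {V : Type*} [Fintype V] [LinearOrder V]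
    (G : SimpleGraph V) [DecidableRel G.Adj]
    (w : Sym2 V → ℕ) (hw : ∀ e ∈ G.edgeSet, 0 < w e)
    (A B : Finset V) (hAB : Disjoint A B)
    (hA : Even A.card) (hB : Even B.card)
    (hnoedge : ∀ u v : V, G.Adj u v → ¬(u ∈ A ∪ B ∧ v ∈ A ∪ B)) :
    ∃ f : Finset (PathSig G) → Polynomial ℤ,
      haf (gallaiSP G w A B) =
        ∑ P ∈ Finset.univ.filter (fun P => IsPerfectABPacking G A B P),
          (-1) ^ thetaB B P * 2 ^ ((A.card + B.card) / 2) *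
            Polynomial.X ^ packingWeight w P * (1 + Polynomial.X * f P) := by
  have hdvd : ∀ u v, (Polynomial.X : Polynomial ℤ) ∣ edgePow G w Polynomial.X u v := by
    intro u v
    rw [edgePow]
    split_ifs with h
    · exact dvd_pow_self _ (hw s(u, v) h).ne'
    · exact dvd_zero _
  set U := Finset.univ.filter fun v => v ∉ A ∧ v ∉ B with hU
  have hTU : Disjoint (A ∪ B) U := by
    rw [Finset.disjoint_left]
    intro v hv
    rw [Finset.mem_union] at hv
    simp only [hU, Finset.mem_filter, Finset.mem_univ, true_and]
    tauto
  choose f hf using fun P : Finset (PathSig G) =>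
    doubledHaf_empty_terminals (edgePow_symm (G := G) w Polynomial.X) hdvd (terminalVec B)
      (U \ P.biUnion PathSig.vertices)
  refine ⟨f, ?_⟩
  rw [haf_gallaiSP_eq_doubledHaf w A B hnoedge, doubledHaf_eq_sum_isPairing _ _ _ hTU]
  symm
  refine Finset.sum_subset_zero_on_sdiff ?_ ?_ ?_
  · intro P hP
    simp only [Finset.mem_filter, Finset.mem_univ, true_and] at hP ⊢
    exact ((isPerfectABPacking_iff hAB hA hB P).1 hP).1
  · intro P hP
    simp only [Finset.mem_sdiff, Finset.mem_filter, Finset.mem_univ, true_and,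
      isPerfectABPacking_iff hAB hA hB, not_and] at hP
    have hex := hP.2 hP.1
    push Not at hex
    obtain ⟨p, hpP, hp1, hp2⟩ := hex
    rw [Finset.prod_eq_zero hpP, zero_mul]
    obtain ⟨h1, h2⟩ := hP.1.2.1 p hpP
    rw [Finset.mem_union] at h1 h2
    have hB' : (p.1 ∈ B ∧ p.2.1 ∉ B) ∨ (p.1 ∉ B ∧ p.2.1 ∈ B) := by tauto
    rcases hB' with ⟨h1, h2⟩ | ⟨h1, h2⟩ <;>
      by_cases he : Even p.2.2.1.length <;> simp [PathSig.term, terminalVec, h1, h2, he, pairDot]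
  · intro P hP
    simp only [Finset.mem_filter, Finset.mem_univ, true_and] at hP
    have hcard : P.card = (A.card + B.card) / 2 := by
      obtain ⟨a, ha⟩ := hA
      obtain ⟨b, hb⟩ := hB
      have := hP.2.2.2
      omega
    rw [prod_term_eq hAB hP.2.1, hf P, hcard]
end

section
/- Let G = (V,E) be a simple undirected graph with positive integer edge weights w, let A, B ⊆ V be disjoint sets of even cardinality with no edge of G having both endpoints in A ∪ B, and let S' and τ := (|A|+|B|)/2 be as in the Gallai construction. Suppose G has a unique shortest perfect (A+B)-path packing 𝓟*. Then in the polynomial haf S' ∈ ℤ[x], the coefficient of x^d is 0 for every d < w(𝓟*), and the coefficient of x^{w(𝓟*)} equals (−1)^{θ(𝓟*)} · 2^τ; in particular haf S' is nonzero modulo 2^{τ+1} and its lowest-degree term determines w(𝓟*). -/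
open scoped Classical

namespace InvolutionPair

variable {W : Type*} (ρ σ : Equiv.Perm W)

/-- The number of steps of `ρ * σ` needed to reach, from `t`, the next fixed point of `ρ`. -/
noncomputable def returnTime (t : W) : ℕ :=
  sInf {k | 0 < k ∧ ρ (((ρ * σ) ^ k) t) = ((ρ * σ) ^ k) t}

/-- The first fixed point of `ρ` met when iterating `ρ * σ` from `t`. -/
noncomputable def partner (t : W) : W := ((ρ * σ) ^ returnTime ρ σ t) t

variable {ρ σ}

lemma returnTime_mem [Finite W] {t : W} (ht : ρ t = t) :
    0 < returnTime ρ σ t ∧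
      ρ (((ρ * σ) ^ returnTime ρ σ t) t) = ((ρ * σ) ^ returnTime ρ σ t) t := by
  have hne : {k | 0 < k ∧ ρ (((ρ * σ) ^ k) t) = ((ρ * σ) ^ k) t}.Nonempty :=
    ⟨orderOf (ρ * σ), orderOf_pos _, by simp [pow_orderOf_eq_one, ht]⟩
  exact Nat.sInf_mem hne

lemma returnTime_pos [Finite W] {t : W} (ht : ρ t = t) : 0 < returnTime ρ σ t :=
  (returnTime_mem ht).1

lemma map_partner [Finite W] {t : W} (ht : ρ t = t) : ρ (partner ρ σ t) = partner ρ σ t :=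
  (returnTime_mem ht).2

lemma returnTime_le {t : W} {k : ℕ} (hk : 0 < k)
    (h : ρ (((ρ * σ) ^ k) t) = ((ρ * σ) ^ k) t) : returnTime ρ σ t ≤ k :=
  Nat.sInf_le ⟨hk, h⟩

lemma returnTime_eq {t : W} {k : ℕ} (hk : 0 < k)
    (h : ρ (((ρ * σ) ^ k) t) = ((ρ * σ) ^ k) t)
    (hlt : ∀ i, 0 < i → i < k → ρ (((ρ * σ) ^ i) t) ≠ ((ρ * σ) ^ i) t) :
    returnTime ρ σ t = k := by
  refine le_antisymm (returnTime_le hk h) ?_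
  refine le_csInf ⟨k, hk, h⟩ ?_
  rintro j ⟨hj, hj'⟩
  by_contra hjk
  exact hlt j hj (by omega) hj'

section

variable (hρ : ∀ x, ρ (ρ x) = x) (hσ : ∀ x, σ (σ x) = x)

include hρ hσ

lemma pow_map_pow (n : ℕ) (x : W) : ((ρ * σ) ^ n) (ρ (((ρ * σ) ^ n) x)) = ρ x := by
  induction n generalizing x with
  | zero => simp
  | succ n ih =>
    have h (y : W) : (ρ * σ) (ρ ((ρ * σ) y)) = ρ y := by simp [Equiv.Perm.mul_apply, hρ, hσ]
    have h1 : ((ρ * σ) ^ (n + 1)) x = (ρ * σ) (((ρ * σ) ^ n) x) := by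
      rw [pow_succ', Equiv.Perm.mul_apply]
    rw [h1, pow_succ, Equiv.Perm.mul_apply, h, ih]

lemma pow_partner [Finite W] {t : W} (ht : ρ t = t) {i : ℕ} (hi : i ≤ returnTime ρ σ t) :
    ((ρ * σ) ^ i) (partner ρ σ t) = ρ (((ρ * σ) ^ (returnTime ρ σ t - i)) t) := by
  have h := pow_map_pow hρ hσ i (((ρ * σ) ^ (returnTime ρ σ t - i)) t)
  rw [← Equiv.Perm.mul_apply ((ρ * σ) ^ i) ((ρ * σ) ^ (returnTime ρ σ t - i)), ← pow_add,
    Nat.add_sub_cancel' hi] at h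
  rw [← h]
  exact congrArg _ (map_partner ht).symm

lemma returnTime_partner [Finite W] {t : W} (ht : ρ t = t) :
    returnTime ρ σ (partner ρ σ t) = returnTime ρ σ t := by
  refine returnTime_eq (returnTime_pos ht) ?_ ?_
  · rw [pow_partner hρ hσ ht le_rfl]
    simp [ht]
  · intro i hi hik h
    rw [pow_partner hρ hσ ht hik.le, hρ] at h
    have := returnTime_le (by omega) h.symm
    omega

lemma partner_partner [Finite W] {t : W} (ht : ρ t = t) :
    partner ρ σ (partner ρ σ t) = t := by
  have h := pow_partner hρ hσ ht le_rfl
  rw [partner, returnTime_partner hρ hσ ht, h]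
  simp [ht]

lemma partner_ne [Finite W] (hfix : ∀ x, σ x ≠ x) {t : W} (ht : ρ t = t) :
    partner ρ σ t ≠ t := by
  intro h
  set k := returnTime ρ σ t with hk
  have hpos := returnTime_pos (σ := σ) ht
  rcases Nat.even_or_odd' k with ⟨i, hi | hi⟩
  · have h1 := pow_partner hρ hσ ht (show i ≤ returnTime ρ σ t by omega)
    rw [h, show returnTime ρ σ t - i = i by omega] at h1
    have := returnTime_le (by omega) h1.symm
    omega
  · have h1 := pow_partner hρ hσ ht (show i ≤ returnTime ρ σ t by omega)
    rw [h, show returnTime ρ σ t - i = i + 1 by omega, pow_succ', Equiv.Perm.mul_apply,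
      Equiv.Perm.mul_apply, hρ] at h1
    exact hfix _ h1.symm

lemma pow_ne_pow [Finite W] (hfix : ∀ x, σ x ≠ x) {t : W} (ht : ρ t = t) {i j : ℕ}
    (hij : i < j) (hj : j ≤ returnTime ρ σ t) : ((ρ * σ) ^ i) t ≠ ((ρ * σ) ^ j) t := by
  intro h
  rw [← Nat.add_sub_cancel' hij.le, pow_add, Equiv.Perm.mul_apply] at h
  have h' := ((ρ * σ) ^ i).injective h
  have hle := returnTime_le (σ := σ) (show 0 < j - i by omega) (by rw [← h', ht])
  rw [show j - i = returnTime ρ σ t by omega] at h'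
  exact partner_ne hρ hσ hfix ht h'.symm

lemma pow_ne_map_pow [Finite W] (hfix : ∀ x, σ x ≠ x) {t : W} (ht : ρ t = t) {i j : ℕ}
    (hij : i < j) (hj : j ≤ returnTime ρ σ t) : ((ρ * σ) ^ i) t ≠ ρ (((ρ * σ) ^ j) t) := by
  intro h
  have h1 := pow_map_pow hρ hσ j t
  rw [← h, ht, ← Equiv.Perm.mul_apply, ← pow_add] at h1
  have hle := returnTime_le (σ := σ) (show 0 < j + i by omega) (by rw [h1, ht])
  have h2 : ((ρ * σ) ^ (j + i - returnTime ρ σ t)) (partner ρ σ t) = t := by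
    rw [partner, ← Equiv.Perm.mul_apply, ← pow_add, Nat.sub_add_cancel hle, h1]
  rcases Nat.eq_zero_or_pos (j + i - returnTime ρ σ t) with h0 | h0
  · rw [h0] at h2
    exact partner_ne hρ hσ hfix ht h2
  · have := returnTime_le h0 (by rw [h2, ht])
    rw [returnTime_partner hρ hσ ht] at this
    omega

lemma eq_or_eq_partner [Finite W] {t s : W} (ht : ρ t = t) (hs : ρ s = s) {n : ℕ}
    (h : ((ρ * σ) ^ n) t = s) : s = t ∨ s = partner ρ σ t := by
  induction n using Nat.strong_induction_on generalizing t with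
  | _ n ih =>
    rcases Nat.eq_zero_or_pos n with rfl | hn
    · simp at h
      exact Or.inl h.symm
    · have hle : returnTime ρ σ t ≤ n := returnTime_le hn (by rw [h, hs])
      have hpos := returnTime_pos (σ := σ) ht
      have h2 : ((ρ * σ) ^ (n - returnTime ρ σ t)) (partner ρ σ t) = s := by
        rw [partner, ← Equiv.Perm.mul_apply, ← pow_add, Nat.sub_add_cancel hle, h]
      have := ih _ (by omega) (map_partner ht) h2
      rw [partner_partner hρ hσ ht] at this
      exact this.symm

lemma sameCycle_iff [Finite W] {t s : W} (ht : ρ t = t) (hs : ρ s = s) :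
    (ρ * σ).SameCycle t s ↔ s = t ∨ s = partner ρ σ t := by
  constructor
  · intro h
    obtain ⟨n, -, -, hn⟩ := h.exists_pow_eq''
    exact eq_or_eq_partner hρ hσ ht hs hn
  · rintro (rfl | rfl)
    · exact Equiv.Perm.SameCycle.refl _ _
    · exact ⟨returnTime ρ σ t, by simp [partner]⟩

lemma sameCycle_map [Finite W] {t x : W} (ht : ρ t = t) (h : (ρ * σ).SameCycle t x) :
    (ρ * σ).SameCycle t (ρ x) := by
  obtain ⟨n, -, -, rfl⟩ := h.exists_pow_eq''
  have := pow_map_pow hρ hσ n t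
  rw [ht] at this
  refine Equiv.Perm.SameCycle.symm ⟨n, ?_⟩
  simpa using this

lemma sameCycle_map_iff [Finite W] {t x : W} (ht : ρ t = t) :
    (ρ * σ).SameCycle t (ρ x) ↔ (ρ * σ).SameCycle t x :=
  ⟨fun h => by simpa [hρ] using sameCycle_map hρ hσ ht h, sameCycle_map hρ hσ ht⟩

lemma sameCycle_map_right_iff [Finite W] {t x : W} (ht : ρ t = t) :
    (ρ * σ).SameCycle t (σ x) ↔ (ρ * σ).SameCycle t x := by
  rw [← sameCycle_map_iff hρ hσ ht, ← Equiv.Perm.mul_apply, Equiv.Perm.sameCycle_apply_right]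

/-- The permutation applying `ρ` on the cycle of `ρ * σ` through a fixed point `t` of `ρ`, and the
identity elsewhere. -/
noncomputable def flip [Finite W] {t : W} (ht : ρ t = t) : Equiv.Perm W :=
  Function.Involutive.toPerm (fun x => if (ρ * σ).SameCycle t x then ρ x else x) (by
    intro x
    by_cases h : (ρ * σ).SameCycle t x
    · simp [h, sameCycle_map_iff hρ hσ ht, hρ]
    · simp [h])

lemma flip_apply [Finite W] {t : W} (ht : ρ t = t) (x : W) :
    flip hρ hσ ht x = if (ρ * σ).SameCycle t x then ρ x else x := rfl

lemma flip_flip [Finite W] {t : W} (ht : ρ t = t) (x : W) :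
    flip hρ hσ ht (flip hρ hσ ht x) = x :=
  Function.Involutive.toPerm_involutive _ x

lemma flip_inv [Finite W] {t : W} (ht : ρ t = t) :
    (flip hρ hσ ht)⁻¹ = flip hρ hσ ht := rfl

lemma flip_fixed [Finite W] {t : W} (ht : ρ t = t) {s : W} (hs : ρ s = s) :
    flip hρ hσ ht s = s := by
  simp [flip_apply, hs]

lemma sameCycle_flip_iff [Finite W] {t : W} (ht : ρ t = t) (x : W) :
    (ρ * σ).SameCycle t (flip hρ hσ ht x) ↔ (ρ * σ).SameCycle t x := by
  rw [flip_apply]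
  split_ifs
  · exact sameCycle_map_iff hρ hσ ht
  · rfl

/-- The conjugate of `σ` by `flip`. -/
noncomputable def switch [Finite W] {t : W} (ht : ρ t = t) : Equiv.Perm W :=
  flip hρ hσ ht * σ * flip hρ hσ ht

lemma switch_apply [Finite W] {t : W} (ht : ρ t = t) (x : W) :
    switch hρ hσ ht x = flip hρ hσ ht (σ (flip hρ hσ ht x)) := rfl

lemma switch_switch_apply [Finite W] {t : W} (ht : ρ t = t) (x : W) :
    switch hρ hσ ht (switch hρ hσ ht x) = x := by
  simp [switch_apply, flip_flip, hσ]

lemma mul_switch [Finite W] {t : W} (ht : ρ t = t) :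
    ρ * switch hρ hσ ht = flip hρ hσ ht * (ρ * σ) * (flip hρ hσ ht)⁻¹ := by
  ext x
  simp only [Equiv.Perm.mul_apply, switch_apply, flip_inv]
  rw [flip_apply hρ hσ ht (σ _), flip_apply hρ hσ ht (ρ _), sameCycle_map_iff hρ hσ ht]
  split_ifs <;> rfl

lemma pow_mul_switch [Finite W] {t : W} (ht : ρ t = t) (n : ℕ) (x : W) :
    ((ρ * switch hρ hσ ht) ^ n) x = flip hρ hσ ht (((ρ * σ) ^ n) (flip hρ hσ ht x)) := by
  rw [mul_switch, conj_pow]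
  rfl

lemma map_flip [Finite W] {t : W} (ht : ρ t = t) (x : W) :
    ρ (flip hρ hσ ht x) = flip hρ hσ ht (ρ x) := by
  rw [flip_apply, flip_apply, sameCycle_map_iff hρ hσ ht]
  split_ifs <;> rfl

lemma partner_switch [Finite W] {t : W} (ht : ρ t = t) {s : W} (hs : ρ s = s) :
    partner ρ (switch hρ hσ ht) s = partner ρ σ s := by
  have hk : returnTime ρ (switch hρ hσ ht) s = returnTime ρ σ s := by
    simp only [returnTime, pow_mul_switch, flip_fixed hρ hσ ht hs, map_flip,
      EmbeddingLike.apply_eq_iff_eq]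
  rw [partner, hk, pow_mul_switch, flip_fixed hρ hσ ht hs]
  exact flip_fixed hρ hσ ht (map_partner hs)

lemma sameCycle_switch [Finite W] {t : W} (ht : ρ t = t) (x : W) :
    (ρ * switch hρ hσ ht).SameCycle t x ↔ (ρ * σ).SameCycle t x := by
  rw [mul_switch, Equiv.Perm.sameCycle_conj, flip_inv, flip_fixed hρ hσ ht ht,
    sameCycle_flip_iff]

lemma switch_switch [Finite W] {t : W} (ht : ρ t = t) :
    switch hρ (switch_switch_apply hρ hσ ht) ht = σ := by
  have h : flip hρ (switch_switch_apply hρ hσ ht) ht = flip hρ hσ ht := by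
    ext x
    rw [flip_apply, flip_apply, sameCycle_switch]
  ext x
  rw [switch_apply, h, switch_apply, flip_flip, flip_flip]

end

end InvolutionPair

namespace SimpleGraph.Walk

variable {V : Type*} {G : SimpleGraph V}

/-- The walk visiting the first terms of a sequence of consecutively adjacent vertices. -/
def ofSeq (f : ℕ → V) (h : ∀ i, G.Adj (f i) (f (i + 1))) : ∀ n, G.Walk (f 0) (f n)
  | 0 => nil
  | n + 1 => (ofSeq f h n).concat (h n)

lemma length_ofSeq (f : ℕ → V) (h : ∀ i, G.Adj (f i) (f (i + 1))) (n : ℕ) :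
    (ofSeq f h n).length = n := by
  induction n with
  | zero => rfl
  | succ n ih => simp [ofSeq, ih]

lemma support_ofSeq (f : ℕ → V) (h : ∀ i, G.Adj (f i) (f (i + 1))) (n : ℕ) :
    (ofSeq f h n).support = (List.range (n + 1)).map f := by
  induction n with
  | zero => rfl
  | succ n ih => rw [ofSeq, support_concat, ih, List.range_succ (n := n + 1)]; simp

lemma getVert_ofSeq (f : ℕ → V) (h : ∀ i, G.Adj (f i) (f (i + 1))) {n i : ℕ} (hi : i ≤ n) :
    (ofSeq f h n).getVert i = f i := by
  rw [getVert_eq_support_getElem _ (by rwa [length_ofSeq])]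
  simp [support_ofSeq]

lemma edges_eq_map_getVert {u v : V} (p : G.Walk u v) :
    p.edges = (List.range p.length).map fun i => s(p.getVert i, p.getVert (i + 1)) := by
  induction p with
  | nil => rfl
  | cons h p ih =>
    rw [edges_cons, ih, length_cons, List.range_succ_eq_map]
    simp [Function.comp_def]

end SimpleGraph.Walk

namespace PathSig

variable {V : Type*} {G : SimpleGraph V}

/-- The number of edges of a path. -/
def length (p : PathSig G) : ℕ := p.2.2.1.length

/-- The `i`-th vertex of a path. -/
def vert (p : PathSig G) (i : ℕ) : V := p.2.2.1.getVert i

/-- The vertices of a path. -/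
def support (p : PathSig G) : List V := p.2.2.1.support

lemma vert_zero (p : PathSig G) : vert p 0 = p.1 := p.2.2.1.getVert_zero

lemma vert_length (p : PathSig G) : vert p (length p) = p.2.1 := p.2.2.1.getVert_length

lemma vert_mem (p : PathSig G) (i : ℕ) : vert p i ∈ support p := p.2.2.1.getVert_mem_support i

lemma mem_support_iff (p : PathSig G) {v : V} :
    v ∈ support p ↔ ∃ i ≤ length p, v = vert p i := by
  rw [support, SimpleGraph.Walk.mem_support_iff_exists_getVert]
  constructor
  · rintro ⟨i, h, hi⟩
    exact ⟨i, hi, h.symm⟩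
  · rintro ⟨i, hi, h⟩
    exact ⟨i, h.symm, hi⟩

lemma vert_inj (p : PathSig G) {i j : ℕ} (hi : i ≤ length p) (hj : j ≤ length p)
    (h : vert p i = vert p j) : i = j :=
  p.2.2.2.getVert_injOn hi hj h

lemma adj_vert (p : PathSig G) {i : ℕ} (hi : i < length p) :
    G.Adj (vert p i) (vert p (i + 1)) :=
  p.2.2.1.adj_getVert_succ hi

lemma sum_edges (w : Sym2 V → ℕ) (p : PathSig G) :
    (p.2.2.1.edges.map w).sum =
      ∑ i ∈ Finset.range (length p), w s(vert p i, vert p (i + 1)) := by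
  rw [SimpleGraph.Walk.edges_eq_map_getVert, List.map_map]
  rw [Finset.sum_range, ← List.sum_ofFn, List.ofFn_eq_map]
  simp [← List.map_coe_finRange_eq_range, length, vert, Function.comp_def]

end PathSig

namespace IsPerfectABPacking

variable {V : Type*} [LinearOrder V] {G : SimpleGraph V} {A B : Finset V}
  {P : Finset (PathSig G)}

open PathSig

lemma fst_mem (hP : IsPerfectABPacking G A B P) {p : PathSig G} (hp : p ∈ P) :
    p.1 ∈ A ∪ B := by
  rcases hP.2.1 p hp with h | h <;> simp [h]

lemma snd_mem (hP : IsPerfectABPacking G A B P) {p : PathSig G} (hp : p ∈ P) :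
    p.2.1 ∈ A ∪ B := by
  rcases hP.2.1 p hp with h | h <;> simp [h]

lemma eq_of_mem_support (hP : IsPerfectABPacking G A B P) {p q : PathSig G} (hp : p ∈ P)
    (hq : q ∈ P) {v : V} (hvp : v ∈ support p) (hvq : v ∈ support q) : p = q := by
  by_contra h
  exact hP.2.2.1 p hp q hq h v hvp hvq

lemma eq_of_vert_eq (hP : IsPerfectABPacking G A B P) {p q : PathSig G} (hp : p ∈ P)
    (hq : q ∈ P) {i j : ℕ} (h : vert p i = vert q j) : p = q :=
  hP.eq_of_mem_support hp hq (vert_mem p i) (h ▸ vert_mem q j)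

lemma fst_ne_snd (hP : IsPerfectABPacking G A B P) {p q : PathSig G} (hp : p ∈ P)
    (hq : q ∈ P) : p.1 ≠ q.2.1 := by
  intro h
  have hpq : p = q := hP.eq_of_vert_eq hp hq (i := 0) (j := length q) (by
    rw [vert_zero, vert_length, h])
  subst hpq
  exact (hP.1 p hp).ne h

lemma exists_end (hP : IsPerfectABPacking G A B P) (hAB : Disjoint A B) (hA : Even A.card)
    (hB : Even B.card) {t : V} (ht : t ∈ A ∪ B) : ∃ p ∈ P, t = p.1 ∨ t = p.2.1 := by
  have h1 : (P.image (fun p => p.1)).card = P.card :=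
    Finset.card_image_of_injOn fun p hp q hq h =>
      hP.eq_of_vert_eq hp hq (i := 0) (j := 0) (by rw [vert_zero, vert_zero]; exact h)
  have h2 : (P.image (fun p => p.2.1)).card = P.card :=
    Finset.card_image_of_injOn fun p hp q hq h =>
      hP.eq_of_vert_eq hp hq (i := length p) (j := length q) (by
        rw [vert_length, vert_length]; exact h)
  have hd : Disjoint (P.image (fun p => p.1)) (P.image (fun p => p.2.1)) := by
    rw [Finset.disjoint_left]
    intro v hv hv'
    obtain ⟨p, hp, rfl⟩ := Finset.mem_image.1 hv
    obtain ⟨q, hq, h⟩ := Finset.mem_image.1 hv'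
    exact hP.fst_ne_snd hp hq h.symm
  have hsub : P.image (fun p => p.1) ∪ P.image (fun p => p.2.1) ⊆ A ∪ B := by
    intro v hv
    rcases Finset.mem_union.1 hv with hv | hv
    · obtain ⟨p, hp, rfl⟩ := Finset.mem_image.1 hv
      exact hP.fst_mem hp
    · obtain ⟨p, hp, rfl⟩ := Finset.mem_image.1 hv
      exact hP.snd_mem hp
  have heq := Finset.eq_of_subset_of_card_le hsub (by
    rw [Finset.card_union_of_disjoint hd, Finset.card_union_of_disjoint hAB, h1, h2, hP.2.2.2]
    obtain ⟨a, ha⟩ := hA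
    obtain ⟨b, hb⟩ := hB
    omega)
  rw [← heq] at ht
  rcases Finset.mem_union.1 ht with hv | hv
  · obtain ⟨p, hp, rfl⟩ := Finset.mem_image.1 hv
    exact ⟨p, hp, Or.inl rfl⟩
  · obtain ⟨p, hp, rfl⟩ := Finset.mem_image.1 hv
    exact ⟨p, hp, Or.inr rfl⟩

lemma vert_notMem (hP : IsPerfectABPacking G A B P) (hAB : Disjoint A B) (hA : Even A.card)
    (hB : Even B.card) {p : PathSig G} (hp : p ∈ P) {i : ℕ} (hi : 0 < i) (hi' : i < length p) :
    vert p i ∉ A ∪ B := by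
  intro h
  obtain ⟨q, hq, hv⟩ := hP.exists_end hAB hA hB h
  rcases hv with hv | hv
  · rw [← vert_zero] at hv
    obtain rfl := hP.eq_of_vert_eq hp hq hv
    have := vert_inj p hi'.le (Nat.zero_le _) hv
    omega
  · rw [← vert_length] at hv
    obtain rfl := hP.eq_of_vert_eq hp hq hv
    have := vert_inj p hi'.le le_rfl hv
    omega

lemma two_le_length (hP : IsPerfectABPacking G A B P)
    (hnoedge : ∀ u v : V, G.Adj u v → ¬(u ∈ A ∪ B ∧ v ∈ A ∪ B)) {p : PathSig G}
    (hp : p ∈ P) : 2 ≤ length p := by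
  by_contra h
  have h' : length p = 0 ∨ length p = 1 := by omega
  rcases h' with h' | h'
  · have := vert_length p
    rw [h', vert_zero] at this
    exact hP.fst_ne_snd hp hp this
  · have hadj := adj_vert p (i := 0) (by omega)
    have := vert_length p
    rw [h'] at this
    rw [zero_add, this, vert_zero] at hadj
    exact hnoedge _ _ hadj ⟨hP.fst_mem hp, hP.snd_mem hp⟩

end IsPerfectABPacking

namespace GallaiVertex

variable {V : Type*} [DecidableEq V] {A B : Finset V}

/-- The vertex of `G` below a vertex of Gallai's auxiliary graph. -/
def base : GallaiVertex A B → V := Sum.elim id Subtype.val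

/-- The copy of `v` in `U'` if the flag is set and `v ∈ U`, and `v` itself otherwise. -/
def lift (A B : Finset V) (v : V) (c : Bool) : GallaiVertex A B :=
  if h : c = true ∧ v ∉ A ∧ v ∉ B then Sum.inr ⟨v, h.2⟩ else Sum.inl v

lemma base_lift (v : V) (c : Bool) : base (lift A B v c) = v := by
  unfold lift
  split_ifs <;> rfl

lemma isRight_lift {v : V} (hv : v ∉ A ∪ B) (c : Bool) : (lift A B v c).isRight = c := by
  rw [Finset.mem_union, not_or] at hv
  cases c <;> simp [lift, hv]

lemma lift_of_mem {v : V} (hv : v ∈ A ∪ B) (c : Bool) : lift A B v c = Sum.inl v := by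
  rw [Finset.mem_union] at hv
  unfold lift
  rw [dif_neg]
  tauto

lemma lift_base_isRight (x : GallaiVertex A B) : lift A B (base x) x.isRight = x := by
  rcases x with v | v
  · simp [lift, base]
  · simp [lift, base, v.2]

variable (A B) in
/-- The involution exchanging `v` and `v'` for `v ∈ U`, and fixing `A ∪ B`. -/
def swap : Equiv.Perm (GallaiVertex A B) :=
  Function.Involutive.toPerm (fun x => lift A B (base x) (!x.isRight)) (by
    intro x
    dsimp only
    rw [base_lift]
    by_cases h : base x ∈ A ∪ B
    · rw [lift_of_mem h, ← lift_of_mem h x.isRight, lift_base_isRight]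
    · rw [isRight_lift h, Bool.not_not, lift_base_isRight])

lemma swap_apply (x : GallaiVertex A B) : swap A B x = lift A B (base x) (!x.isRight) := rfl

lemma swap_swap (x : GallaiVertex A B) : swap A B (swap A B x) = x :=
  Function.Involutive.toPerm_involutive _ x

lemma base_swap (x : GallaiVertex A B) : base (swap A B x) = base x := base_lift _ _

lemma isRight_swap {x : GallaiVertex A B} (hx : base x ∉ A ∪ B) :
    (swap A B x).isRight = !x.isRight := isRight_lift hx _

lemma swap_lift (v : V) (c : Bool) : swap A B (lift A B v c) = lift A B v (!c) := by
  rw [swap_apply, base_lift]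
  by_cases h : v ∈ A ∪ B
  · rw [lift_of_mem h, lift_of_mem h]
  · rw [isRight_lift h]

lemma eq_inl_of_base_mem {x : GallaiVertex A B} (hx : base x ∈ A ∪ B) :
    x = Sum.inl (base x) := by
  rw [← lift_of_mem hx x.isRight, lift_base_isRight]

lemma swap_eq_self_iff {x : GallaiVertex A B} : swap A B x = x ↔ base x ∈ A ∪ B := by
  constructor
  · intro h
    by_contra hx
    have := isRight_swap hx
    rw [h] at this
    cases h' : x.isRight <;> simp [h'] at this
  · intro h
    rw [swap_apply, lift_of_mem h, ← eq_inl_of_base_mem h]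

lemma swap_inl {t : V} (ht : t ∈ A ∪ B) : swap A B (Sum.inl t) = Sum.inl t :=
  swap_eq_self_iff.2 ht

lemma eq_of_base_eq_of_isRight_eq {x y : GallaiVertex A B} (h : base x = base y)
    (h' : x.isRight = y.isRight) : x = y := by
  rw [← lift_base_isRight x, h, h', lift_base_isRight]

lemma base_eq_iff {x y : GallaiVertex A B} : base x = base y ↔ x = y ∨ x = swap A B y := by
  constructor
  · intro h
    by_cases hc : x.isRight = y.isRight
    · exact Or.inl (eq_of_base_eq_of_isRight_eq h hc)
    · right
      rw [← lift_base_isRight x, h, swap_apply]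
      congr 1
      cases hx : x.isRight <;> cases hy : y.isRight <;> simp_all
  · rintro (rfl | rfl)
    · rfl
    · rw [base_swap]

end GallaiVertex

@[to_additive]
lemma prod_univ_eq_prod_filter_lt {ι α M : Type*} [Fintype ι] [LinearOrder α] [CommMonoid M]
    {e : ι → α} (he : Function.Injective e) {σ : Equiv.Perm ι} (hσ : ∀ x, σ (σ x) = x)
    (hfix : ∀ x, σ x ≠ x) (F : ι → M) :
    ∏ x, F x = ∏ x ∈ Finset.univ.filter (fun x => e x < e (σ x)), F x * F (σ x) := by
  rw [← Finset.prod_filter_mul_prod_filter_not Finset.univ (fun x => e x < e (σ x)),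
    Finset.prod_mul_distrib]
  congr 1
  refine Finset.prod_nbij' (fun x => σ x) (fun x => σ x) ?_ ?_ ?_ ?_ ?_
  · intro x hx
    simp only [Finset.mem_filter, Finset.mem_univ, true_and, not_lt, hσ] at hx ⊢
    exact lt_of_le_of_ne hx fun h => hfix x (he h)
  · intro x hx
    simp only [Finset.mem_filter, Finset.mem_univ, true_and, not_lt, hσ] at hx ⊢
    exact hx.le
  · intro x _
    exact hσ x
  · intro x _
    exact hσ x
  · intro x _
    simp only [hσ]

namespace GallaiVertex

section

variable {V : Type*} [DecidableEq V] {G : SimpleGraph V} {A B : Finset V}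

variable (G) in
/-- Adjacency in Gallai's auxiliary graph. -/
def HAdj (x y : GallaiVertex A B) : Prop :=
  (base x = base y ∧ x ≠ y) ∨
    (G.Adj (base x) (base y) ∧ (base x ∉ A ∪ B → base y ∉ A ∪ B → x.isRight = y.isRight))

/-- The weight of an edge of Gallai's auxiliary graph. -/
def weight (w : Sym2 V → ℕ) (x y : GallaiVertex A B) : ℕ :=
  if base x = base y then 0 else w s(base x, base y)

/-- The sign contributed by the end `x` of an edge `xy` of Gallai's auxiliary graph. -/
def sign (x y : GallaiVertex A B) : ℤ := if base x ∈ B ∧ y.isRight = true then -1 else 1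

lemma HAdj.symm {x y : GallaiVertex A B} (h : HAdj G x y) : HAdj G y x := by
  rcases h with h | h
  · exact Or.inl ⟨h.1.symm, h.2.symm⟩
  · exact Or.inr ⟨h.1.symm, fun h1 h2 => (h.2 h2 h1).symm⟩

lemma HAdj.ne {x y : GallaiVertex A B} (h : HAdj G x y) : x ≠ y := by
  rcases h with h | h
  · exact h.2
  · rintro rfl
    exact h.1.ne rfl

lemma HAdj.adj {x y : GallaiVertex A B} (h : HAdj G x y) (hne : y ≠ swap A B x) :
    G.Adj (base x) (base y) := by
  rcases h with h | h
  · rcases base_eq_iff.1 h.1.symm with h' | h'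
    · exact absurd h'.symm h.2
    · exact absurd h' hne
  · exact h.1

lemma HAdj.base_notMem {x y : GallaiVertex A B}
    (hnoedge : ∀ u v : V, G.Adj u v → ¬(u ∈ A ∪ B ∧ v ∈ A ∪ B)) (h : HAdj G x y)
    (hx : base x ∈ A ∪ B) : base y ∉ A ∪ B := by
  intro hy
  rcases h with h | h
  · exact h.2 (by rw [eq_inl_of_base_mem hx, eq_inl_of_base_mem hy, h.1])
  · exact hnoedge _ _ h.1 ⟨hx, hy⟩

lemma HAdj.map_swap {x y : GallaiVertex A B} (h : HAdj G x y) :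
    HAdj G (swap A B x) (swap A B y) := by
  unfold HAdj at *
  rw [base_swap, base_swap]
  rcases h with h | h
  · exact Or.inl ⟨h.1, fun h' => h.2 ((swap A B).injective h')⟩
  · refine Or.inr ⟨h.1, fun h1 h2 => ?_⟩
    rw [isRight_swap h1, isRight_swap h2, h.2 h1 h2]

lemma hAdj_lift {u v : V} (h : G.Adj u v) (c : Bool) :
    HAdj G (lift A B u c) (lift A B v c) := by
  refine Or.inr ?_
  rw [base_lift, base_lift]
  exact ⟨h, fun h1 h2 => by rw [isRight_lift h1, isRight_lift h2]⟩

lemma weight_comm (w : Sym2 V → ℕ) (x y : GallaiVertex A B) : weight w x y = weight w y x := by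
  simp only [weight, eq_comm, Sym2.eq_swap]

lemma gallaiSP_apply [DecidableRel G.Adj] (w : Sym2 V → ℕ) (x y : GallaiVertex A B) :
    gallaiSP G w A B x y =
      if HAdj G x y then
        Polynomial.C (sign x y * sign y x) * Polynomial.X ^ weight w x y
      else 0 := by
  rcases x with u | u <;> rcases y with v | v
  · by_cases h : G.Adj u v
    · simp [gallaiSP, HAdj, sign, weight, base, h, h.ne]
    · by_cases h' : u = v <;> simp [gallaiSP, HAdj, base, h, h']
  · have hv := v.2
    by_cases h' : u = v.1
    · subst h'
      simp [gallaiSP, HAdj, sign, weight, base, hv]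
    · by_cases h : G.Adj u v <;> by_cases hA : u ∈ A <;> by_cases hB : u ∈ B <;>
        simp [gallaiSP, HAdj, sign, weight, base, h, h', hA, hB, hv]
  · have hu := u.2
    by_cases h' : v = u.1
    · subst h'
      simp [gallaiSP, HAdj, sign, weight, base, hu]
    · by_cases h : G.Adj v u <;> by_cases hA : v ∈ A <;> by_cases hB : v ∈ B <;>
        simp [gallaiSP, HAdj, sign, weight, base, h, h', hA, hB, hu, G.adj_comm u.1 v,
          Sym2.eq_swap, Ne.symm h', eq_comm]
  · have hu := u.2
    have hv := v.2
    by_cases h : G.Adj u.1 v.1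
    · simp [gallaiSP, HAdj, sign, weight, base, h, h.ne, hu, hv]
    · by_cases h' : u.1 = v.1 <;> simp [gallaiSP, HAdj, base, h, h', Subtype.ext_iff]

variable (G) in
/-- A perfect matching of Gallai's auxiliary graph, as an involution. -/
structure IsMatching (σ : Equiv.Perm (GallaiVertex A B)) : Prop where
  involutive : ∀ x, σ (σ x) = x
  hAdj : ∀ x, HAdj G x (σ x)

lemma IsMatching.fixedPointFree {σ : Equiv.Perm (GallaiVertex A B)} (h : IsMatching G σ) :
    ∀ x, σ x ≠ x := fun x => (h.hAdj x).ne.symm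

/-- The sign of a perfect matching of Gallai's auxiliary graph. -/
def totalSign [Fintype V] (σ : Equiv.Perm (GallaiVertex A B)) : ℤ := ∏ x, sign x (σ x)

/-- Twice the weight of a perfect matching of Gallai's auxiliary graph. -/
def totalWeight [Fintype V] (w : Sym2 V → ℕ) (σ : Equiv.Perm (GallaiVertex A B)) : ℕ :=
  ∑ x, weight w x (σ x)

lemma IsMatching.totalWeight_eq_two_mul [Fintype V] {σ : Equiv.Perm (GallaiVertex A B)}
    (h : IsMatching G σ) (w : Sym2 V → ℕ) :
    totalWeight w σ = 2 * ∑ x ∈ Finset.univ.filter (fun x =>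
      Fintype.equivFin (GallaiVertex A B) x < Fintype.equivFin (GallaiVertex A B) (σ x)),
      weight w x (σ x) := by
  rw [totalWeight, sum_univ_eq_sum_filter_lt (Fintype.equivFin (GallaiVertex A B)).injective
    h.involutive h.fixedPointFree, Finset.mul_sum]
  refine Finset.sum_congr rfl fun x _ => ?_
  rw [h.involutive, weight_comm w (σ x), two_mul]

lemma haf_gallaiSP [Fintype V] [DecidableRel G.Adj] (w : Sym2 V → ℕ) :
    haf (gallaiSP G w A B) =
      ∑ σ ∈ Finset.univ.filter (fun σ : Equiv.Perm (GallaiVertex A B) => IsMatching G σ),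
        Polynomial.C (totalSign σ) * Polynomial.X ^ (totalWeight w σ / 2) := by
  unfold haf
  symm
  apply Finset.sum_subset_zero_on_sdiff
  · intro σ hσ
    simp only [Finset.mem_filter, Finset.mem_univ, true_and] at hσ ⊢
    exact ⟨Equiv.ext hσ.involutive, hσ.fixedPointFree⟩
  · intro σ hσ
    simp only [Finset.mem_sdiff, Finset.mem_filter, Finset.mem_univ, true_and] at hσ
    obtain ⟨⟨hσ1, hσ2⟩, hσ3⟩ := hσ
    have hinv : ∀ x, σ (σ x) = x := fun x => Equiv.congr_fun hσ1 x
    have hex : ∃ x, ¬ HAdj G x (σ x) := by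
      by_contra! h
      exact hσ3 ⟨hinv, h⟩
    obtain ⟨x, hx⟩ := hex
    rcases lt_or_gt_of_ne (fun h => hσ2 x ((Fintype.equivFin _).injective h).symm :
        Fintype.equivFin _ x ≠ Fintype.equivFin _ (σ x)) with h | h
    · refine Finset.prod_eq_zero (i := x) (by simpa using h) ?_
      rw [gallaiSP_apply w, if_neg hx]
    · refine Finset.prod_eq_zero (i := σ x) (by simpa [hinv] using h) ?_
      rw [gallaiSP_apply w, if_neg]
      rw [hinv]
      exact fun h' => hx h'.symm
  · intro σ hσ
    simp only [Finset.mem_filter, Finset.mem_univ, true_and] at hσ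
    have h1 := prod_univ_eq_prod_filter_lt (Fintype.equivFin (GallaiVertex A B)).injective
      hσ.involutive hσ.fixedPointFree (fun x => sign x (σ x))
    simp only [hσ.involutive] at h1
    rw [Finset.prod_congr rfl fun x _ => by
      rw [gallaiSP_apply w, if_pos (hσ.hAdj x)]]
    rw [Finset.prod_mul_distrib, Finset.prod_pow_eq_pow_sum, ← map_prod, ← h1, totalSign,
      hσ.totalWeight_eq_two_mul, Nat.mul_div_cancel_left _ two_pos]

end

section

variable {V : Type*} [Fintype V] [DecidableEq V] {G : SimpleGraph V} {A B : Finset V}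

open InvolutionPair

lemma IsMatching.base_partner_mem {σ : Equiv.Perm (GallaiVertex A B)} {t : V}
    (ht : t ∈ A ∪ B) : base (partner (swap A B) σ (Sum.inl t)) ∈ A ∪ B :=
  swap_eq_self_iff.1 (map_partner (swap_inl ht))

/-- Exchange the two copies of `U` along the component of the terminal `t`. -/
noncomputable def IsMatching.switch {σ : Equiv.Perm (GallaiVertex A B)} (h : IsMatching G σ)
    {t : V} (ht : t ∈ A ∪ B) : Equiv.Perm (GallaiVertex A B) :=
  InvolutionPair.switch swap_swap h.involutive (swap_inl ht)

variable {σ : Equiv.Perm (GallaiVertex A B)} (h : IsMatching G σ)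

include h

lemma IsMatching.switch_apply {t : V} (ht : t ∈ A ∪ B) (x : GallaiVertex A B) :
    h.switch ht x = if (swap A B * σ).SameCycle (Sum.inl t) x then
      swap A B (σ (swap A B x)) else σ x := by
  rw [IsMatching.switch, InvolutionPair.switch_apply, flip_apply, flip_apply]
  by_cases hx : (swap A B * σ).SameCycle (Sum.inl t) x
  · rw [if_pos hx, if_pos hx, if_pos]
    rw [sameCycle_map_right_iff swap_swap h.involutive (swap_inl ht),
      sameCycle_map_iff swap_swap h.involutive (swap_inl ht)]
    exact hx
  · rw [if_neg hx, if_neg hx, if_neg]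
    rwa [sameCycle_map_right_iff swap_swap h.involutive (swap_inl ht)]

lemma IsMatching.isMatching_switch {t : V} (ht : t ∈ A ∪ B) : IsMatching G (h.switch ht) where
  involutive := switch_switch_apply swap_swap h.involutive (swap_inl ht)
  hAdj x := by
    rw [h.switch_apply]
    split_ifs
    · simpa only [swap_swap] using (h.hAdj (swap A B x)).map_swap
    · exact h.hAdj x

lemma IsMatching.switch_switch {t : V} (ht : t ∈ A ∪ B) :
    (h.isMatching_switch ht).switch ht = σ :=
  InvolutionPair.switch_switch swap_swap h.involutive (swap_inl ht)

lemma IsMatching.partner_switch {t s : V} (ht : t ∈ A ∪ B) (hs : s ∈ A ∪ B) :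
    partner (swap A B) (h.switch ht) (Sum.inl s) = partner (swap A B) σ (Sum.inl s) :=
  InvolutionPair.partner_switch swap_swap h.involutive (swap_inl ht) (swap_inl hs)

lemma IsMatching.totalWeight_switch (w : Sym2 V → ℕ) {t : V} (ht : t ∈ A ∪ B) :
    totalWeight w (h.switch ht) = totalWeight w σ := by
  have hb (x : GallaiVertex A B) :
      base (InvolutionPair.flip swap_swap h.involutive (swap_inl ht) x) = base x := by
    rw [flip_apply]
    split_ifs
    · exact base_swap x
    · rfl
  unfold totalWeight
  rw [← Equiv.sum_comp (InvolutionPair.flip swap_swap h.involutive (swap_inl ht))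
    (fun x => weight w x (σ x))]
  refine Finset.sum_congr rfl fun x _ => ?_
  rw [IsMatching.switch, InvolutionPair.switch_apply]
  simp only [weight, hb]

lemma IsMatching.totalSign_switch (hAB : Disjoint A B)
    (hnoedge : ∀ u v : V, G.Adj u v → ¬(u ∈ A ∪ B ∧ v ∈ A ∪ B)) {t : V} (ht : t ∈ A)
    (htB : base (partner (swap A B) σ (Sum.inl t)) ∈ B) :
    totalSign (h.switch (Finset.mem_union_left B ht)) = -totalSign σ := by
  have htT : t ∈ A ∪ B := Finset.mem_union_left B ht
  set s := partner (swap A B) σ (Sum.inl t) with hs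
  have hrec : ∀ x : GallaiVertex A B, sign x (h.switch (Finset.mem_union_left B ht) x) =
      (if x = s then -1 else 1) * sign x (σ x) := by
    intro x
    by_cases hx : base x ∈ B
    · have hxT : base x ∈ A ∪ B := Finset.mem_union_right A hx
      have hcyc := sameCycle_iff swap_swap h.involutive (swap_inl htT) (swap_eq_self_iff.2 hxT)
      have hxt : x ≠ Sum.inl t := by
        rintro rfl
        exact Finset.disjoint_left.1 hAB ht hx
      rw [← hs, or_iff_right hxt] at hcyc
      rw [h.switch_apply]
      simp only [hcyc]
      split_ifs with hxs
      · rw [swap_eq_self_iff.2 hxT]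
        have := (h.hAdj x).base_notMem hnoedge hxT
        simp only [sign, isRight_swap this, hx, true_and]
        cases (σ x).isRight <;> simp
      · simp
    · have hxs : x ≠ s := by
        rintro rfl
        exact hx htB
      simp [sign, hx, hxs]
  simp only [totalSign, hrec, Finset.prod_mul_distrib]
  simp

lemma IsMatching.switch_ne
    (hnoedge : ∀ u v : V, G.Adj u v → ¬(u ∈ A ∪ B ∧ v ∈ A ∪ B)) {t : V} (ht : t ∈ A ∪ B) :
    h.switch ht ≠ σ := by
  intro heq
  have h1 := h.switch_apply ht (Sum.inl t)
  rw [heq, if_pos (Equiv.Perm.SameCycle.refl _ _), swap_inl ht] at h1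
  exact (h.hAdj (Sum.inl t)).base_notMem hnoedge ht (swap_eq_self_iff.1 h1.symm)

end

section

variable {V : Type*} [Fintype V] [LinearOrder V] {G : SimpleGraph V} {A B : Finset V}

open InvolutionPair

/-- The terminals in `A` whose component contains a terminal in `B`. -/
noncomputable def mixed (σ : Equiv.Perm (GallaiVertex A B)) : Finset V :=
  A.filter fun t => base (partner (swap A B) σ (Sum.inl t)) ∈ B

lemma IsMatching.mixed_switch {σ : Equiv.Perm (GallaiVertex A B)} (h : IsMatching G σ) {t : V}
    (ht : t ∈ A ∪ B) : mixed (h.switch ht) = mixed σ :=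
  Finset.filter_congr fun s hs => by rw [h.partner_switch ht (Finset.mem_union_left B hs)]

variable (G) in
/-- A matching of the auxiliary graph without a component joining `A` and `B`. -/
def IsPure (σ : Equiv.Perm (GallaiVertex A B)) : Prop := IsMatching G σ ∧ mixed σ = ∅

lemma haf_gallaiSP_eq_sum_isPure [DecidableRel G.Adj] (w : Sym2 V → ℕ) (hAB : Disjoint A B)
    (hnoedge : ∀ u v : V, G.Adj u v → ¬(u ∈ A ∪ B ∧ v ∈ A ∪ B)) :
    haf (gallaiSP G w A B) =
      ∑ σ ∈ Finset.univ.filter (fun σ : Equiv.Perm (GallaiVertex A B) => IsPure G σ),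
        Polynomial.C (totalSign σ) * Polynomial.X ^ (totalWeight w σ / 2) := by
  have hsub : ∀ {σ : Equiv.Perm (GallaiVertex A B)} (hne : (mixed σ).Nonempty),
      (mixed σ).min' hne ∈ A ∪ B := fun hne =>
    Finset.mem_union_left B (Finset.mem_filter.1 (Finset.min'_mem _ hne)).1
  rw [haf_gallaiSP w, ← Finset.sum_filter_add_sum_filter_not _ (fun σ => mixed σ = ∅),
    Finset.filter_filter, Finset.filter_filter]
  refine ((congrArg _ ?_).trans (add_zero _)).trans
    (Finset.sum_congr (Finset.filter_congr fun _ _ => Iff.rfl) fun _ _ => rfl)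
  have hmem : ∀ σ ∈ Finset.univ.filter (fun σ : Equiv.Perm (GallaiVertex A B) =>
      IsMatching G σ ∧ ¬ mixed σ = ∅), IsMatching G σ ∧ (mixed σ).Nonempty := fun σ hσ => by
    simpa [Finset.nonempty_iff_ne_empty] using hσ
  refine Finset.sum_involution
    (fun σ hσ => (hmem σ hσ).1.switch (hsub (hmem σ hσ).2)) ?_ ?_ ?_ ?_
  · intro σ hσ
    obtain ⟨h, hne⟩ := hmem σ hσ
    obtain ⟨htA, htB⟩ := Finset.mem_filter.1 (Finset.min'_mem _ hne)
    rw [h.totalWeight_switch, h.totalSign_switch hAB hnoedge htA htB]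
    simp
  · intro σ hσ _
    exact (hmem σ hσ).1.switch_ne hnoedge _
  · intro σ hσ
    obtain ⟨h, hne⟩ := hmem σ hσ
    simp only [Finset.mem_filter, Finset.mem_univ, true_and]
    exact ⟨h.isMatching_switch _, by rw [h.mixed_switch]; exact hne.ne_empty⟩
  · intro σ hσ
    obtain ⟨h, hne⟩ := hmem σ hσ
    have key : ∀ {t s : V} (ht : t ∈ A ∪ B) (hs : s ∈ A ∪ B), s = t →
        (h.isMatching_switch ht).switch hs = σ := by
      rintro t _ ht hs rfl
      exact h.switch_switch ht
    refine key _ _ ?_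
    simp only [h.mixed_switch]

end

open PathSig InvolutionPair

section

variable {V : Type*} [DecidableEq V] {G : SimpleGraph V} {A B : Finset V}

variable (A B) in
/-- A path with two or more edges whose ends are terminals and whose inner vertices are not. -/
structure IsTerminalPath (p : PathSig G) : Prop where
  fst_mem : p.1 ∈ A ∪ B
  snd_mem : p.2.1 ∈ A ∪ B
  vert_notMem : ∀ {i : ℕ}, 0 < i → i < length p → vert p i ∉ A ∪ B
  two_le_length : 2 ≤ length p

namespace IsTerminalPath

variable {p : PathSig G} (hp : IsTerminalPath A B p) {y : ℕ → GallaiVertex A B}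
  (hy : ∀ i ≤ length p, base (y i) = vert p i)

include hp hy

lemma eq_inl_zero : y 0 = Sum.inl p.1 := by
  have h0 := hy 0 (Nat.zero_le _)
  rw [vert_zero] at h0
  rw [← h0]
  exact eq_inl_of_base_mem (h0 ▸ hp.fst_mem)

lemma eq_inl_length : y (length p) = Sum.inl p.2.1 := by
  have h0 := hy _ le_rfl
  rw [vert_length] at h0
  rw [← h0]
  exact eq_inl_of_base_mem (h0 ▸ hp.snd_mem)

omit hp in
lemma seq_inj {i j : ℕ} (hi : i ≤ length p) (hj : j ≤ length p) (h : y i = y j) : i = j :=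
  vert_inj p hi hj (by rw [← hy i hi, ← hy j hj, h])

lemma ne_swap {i j : ℕ} (hi : i < length p) (hj : j < length p) :
    y i ≠ swap A B (y (j + 1)) := by
  intro h
  have hij : i = j + 1 := vert_inj p hi.le hj (by
    rw [← hy i hi.le, ← hy (j + 1) hj, h, base_swap])
  subst hij
  have := swap_eq_self_iff.1 h.symm
  rw [hy _ hj] at this
  exact hp.vert_notMem (by omega) hi this

lemma eq_or_eq_swap {x : GallaiVertex A B} (hx : base x ∈ support p) :
    (∃ i < length p, x = y i) ∨ ∃ i < length p, x = swap A B (y (i + 1)) := by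
  have h2 := hp.two_le_length
  obtain ⟨i, hi, hv⟩ := (mem_support_iff p).1 hx
  rw [← hy i hi] at hv
  rcases base_eq_iff.1 hv with rfl | rfl
  · rcases hi.lt_or_eq with hi | rfl
    · exact Or.inl ⟨i, hi, rfl⟩
    · refine Or.inr ⟨length p - 1, by omega, ?_⟩
      rw [Nat.sub_add_cancel (by omega), hp.eq_inl_length hy, swap_inl hp.snd_mem]
  · rcases Nat.eq_zero_or_pos i with rfl | hi0
    · refine Or.inl ⟨0, by omega, ?_⟩
      rw [hp.eq_inl_zero hy, swap_inl hp.fst_mem]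
    · exact Or.inr ⟨i - 1, by omega, by rw [Nat.sub_add_cancel hi0]⟩

end IsTerminalPath

/-- The `i`-th vertex of the auxiliary graph met from the terminal `t`, alternating between
matching edges and exchanging copies. -/
def orbit (σ : Equiv.Perm (GallaiVertex A B)) (t : V) (i : ℕ) : GallaiVertex A B :=
  ((swap A B * σ) ^ i) (Sum.inl t)

lemma orbit_zero (σ : Equiv.Perm (GallaiVertex A B)) (t : V) : orbit σ t 0 = Sum.inl t := rfl

lemma orbit_succ (σ : Equiv.Perm (GallaiVertex A B)) (t : V) (i : ℕ) :
    orbit σ t (i + 1) = swap A B (σ (orbit σ t i)) := by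
  rw [orbit, pow_succ', Equiv.Perm.mul_apply, Equiv.Perm.mul_apply, orbit]

lemma swap_orbit_succ (σ : Equiv.Perm (GallaiVertex A B)) (t : V) (i : ℕ) :
    swap A B (orbit σ t (i + 1)) = σ (orbit σ t i) := by
  rw [orbit_succ, swap_swap]

/-- The matching `σ` projects onto the path `p`. -/
def Follows (σ : Equiv.Perm (GallaiVertex A B)) (p : PathSig G) : Prop :=
  ∀ i ≤ length p, base (orbit σ p.1 i) = vert p i

namespace Follows

variable {σ : Equiv.Perm (GallaiVertex A B)} {p : PathSig G} (h : Follows σ p)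

include h

lemma base_apply {i : ℕ} (hi : i < length p) :
    base (σ (orbit σ p.1 i)) = vert p (i + 1) := by
  rw [← swap_orbit_succ, base_swap, h _ hi]

lemma isRight_orbit (hσ : IsMatching G σ) (hp : IsTerminalPath A B p) {j : ℕ}
    (hj : j + 1 < length p) :
    (orbit σ p.1 (j + 1)).isRight =
      ((σ (Sum.inl p.1)).isRight ^^ decide (Even j)) := by
  induction j with
  | zero =>
    rw [orbit_succ, isRight_swap]
    · simp [orbit_zero]
    · rw [h.base_apply (by omega)]
      exact hp.vert_notMem (by omega) hj
  | succ j ih =>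
    have hj1 : base (orbit σ p.1 (j + 1)) ∉ A ∪ B := by
      rw [h _ (by omega)]
      exact hp.vert_notMem (by omega) (by omega)
    have hj2 : base (σ (orbit σ p.1 (j + 1))) ∉ A ∪ B := by
      rw [h.base_apply (by omega)]
      exact hp.vert_notMem (by omega) hj
    have hr : (orbit σ p.1 (j + 1)).isRight = (σ (orbit σ p.1 (j + 1))).isRight := by
      rcases hσ.hAdj (orbit σ p.1 (j + 1)) with h' | h'
      · rw [h _ (by omega), h.base_apply (by omega)] at h'
        exact absurd (vert_inj p (by omega) (by omega) h'.1) (by omega)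
      · exact h'.2 hj1 hj2
    rw [orbit_succ, isRight_swap hj2, ← hr, ih (by omega)]
    by_cases he : Even j <;> simp [he, Nat.even_add_one]

@[to_additive]
lemma prod_support [Fintype V] {M : Type*} [CommMonoid M] (hp : IsTerminalPath A B p)
    (F : GallaiVertex A B → M) :
    ∏ x ∈ Finset.univ.filter (fun x => base x ∈ support p), F x =
      ∏ i ∈ Finset.range (length p), F (orbit σ p.1 i) * F (σ (orbit σ p.1 i)) := by
  have hset : Finset.univ.filter (fun x : GallaiVertex A B => base x ∈ support p) =
      (Finset.range (length p)).image (fun i => orbit σ p.1 i) ∪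
        (Finset.range (length p)).image (fun i => σ (orbit σ p.1 i)) := by
    ext x
    simp only [Finset.mem_filter, Finset.mem_univ, true_and, Finset.mem_union, Finset.mem_image,
      Finset.mem_range]
    constructor
    · intro hx
      rcases hp.eq_or_eq_swap h hx with ⟨i, hi, rfl⟩ | ⟨i, hi, rfl⟩
      · exact Or.inl ⟨i, hi, rfl⟩
      · exact Or.inr ⟨i, hi, (swap_orbit_succ σ p.1 i).symm⟩
    · rintro (⟨i, hi, rfl⟩ | ⟨i, hi, rfl⟩)
      · rw [h i hi.le]
        exact vert_mem p i
      · rw [h.base_apply hi]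
        exact vert_mem p _
  rw [hset, Finset.prod_union, Finset.prod_image, Finset.prod_image, Finset.prod_mul_distrib]
  · intro i hi j hj hij
    exact IsTerminalPath.seq_inj h (Finset.mem_range.1 hi).le (Finset.mem_range.1 hj).le
      (σ.injective hij)
  · intro i hi j hj hij
    exact IsTerminalPath.seq_inj h (Finset.mem_range.1 hi).le (Finset.mem_range.1 hj).le hij
  · rw [Finset.disjoint_left]
    intro x hx hx'
    obtain ⟨i, hi, rfl⟩ := Finset.mem_image.1 hx
    obtain ⟨j, hj, hij⟩ := Finset.mem_image.1 hx'
    rw [← swap_orbit_succ] at hij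
    exact hp.ne_swap h (Finset.mem_range.1 hi) (Finset.mem_range.1 hj) hij.symm

lemma partner_eq [Fintype V] (hp : IsTerminalPath A B p) :
    partner (swap A B) σ (Sum.inl p.1) = Sum.inl p.2.1 := by
  have h2 := hp.two_le_length
  have hlen : orbit σ p.1 (length p) = Sum.inl p.2.1 := hp.eq_inl_length h
  have hk : returnTime (swap A B) σ (Sum.inl p.1) = length p := by
    refine returnTime_eq (by omega) ?_ ?_
    · change swap A B (orbit σ p.1 (length p)) = orbit σ p.1 (length p)
      rw [hlen, swap_inl hp.snd_mem]
    · intro i hi hi' heq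
      have := swap_eq_self_iff.1 heq
      change base (orbit σ p.1 i) ∈ A ∪ B at this
      rw [h i hi'.le] at this
      exact hp.vert_notMem hi hi' this
  rw [partner, hk]
  exact hlen

lemma prod_sign (hσ : IsMatching G σ) (hp : IsTerminalPath A B p)
    (hends : p.1 ∈ B ↔ p.2.1 ∈ B) :
    ∏ i ∈ Finset.range (length p),
      sign (orbit σ p.1 i) (σ (orbit σ p.1 i)) * sign (σ (orbit σ p.1 i)) (orbit σ p.1 i) =
      if p.1 ∈ B ∧ p.2.1 ∈ B ∧ Even p.2.2.1.length then -1 else 1 := by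
  have hsign : ∀ x y : GallaiVertex A B, base x ∉ B → sign x y = 1 := by
    intro x y hx
    simp [sign, hx]
  have hint : ∀ {i : ℕ}, 0 < i → i < length p → vert p i ∉ B := fun h1 h2 h3 =>
    hp.vert_notMem h1 h2 (Finset.mem_union_right A h3)
  obtain ⟨m, hm⟩ := Nat.exists_eq_add_of_le' hp.two_le_length
  have hlen : p.2.2.1.length = m + 2 := hm
  rw [hm, Finset.prod_range_succ, Finset.prod_range_succ', Finset.prod_eq_one, one_mul]
  · rw [hsign (σ (orbit σ p.1 0)), hsign (orbit σ p.1 (m + 1)), mul_one, one_mul]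
    · have h0 : base (orbit σ p.1 0) = p.1 := rfl
      have h1 : base (σ (orbit σ p.1 (m + 1))) = p.2.1 := by
        rw [h.base_apply (by omega), ← vert_length, hm]
      by_cases hB : p.1 ∈ B
      · have hB' := hends.1 hB
        have hr := h.isRight_orbit hσ hp (show m + 1 < length p by omega)
        rw [← orbit_zero σ p.1] at hr
        simp only [sign, h0, h1, hB, hB', true_and, hr, hlen, Nat.even_add_one]
        generalize (σ (orbit σ p.1 0)).isRight = b
        cases b <;> by_cases he : Even m <;> simp [he]
      · have hB' := mt hends.2 hB
        simp [sign, h0, h1, hB, hB']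
    · rw [h _ (by omega)]
      exact hint (by omega) (by omega)
    · rw [h.base_apply (by omega)]
      exact hint (by omega) (by omega)
  · intro i hi
    have hi := Finset.mem_range.1 hi
    rw [hsign, hsign, mul_one]
    · rw [h.base_apply (by omega)]
      exact hint (by omega) (by omega)
    · rw [h _ (by omega)]
      exact hint (by omega) (by omega)

end Follows

end

section

variable {V : Type*} [LinearOrder V] {G : SimpleGraph V} {A B : Finset V}
  {P : Finset (PathSig G)}

lemma _root_.IsPerfectABPacking.isTerminalPath (hP : IsPerfectABPacking G A B P)
    (hAB : Disjoint A B) (hA : Even A.card) (hB : Even B.card)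
    (hnoedge : ∀ u v : V, G.Adj u v → ¬(u ∈ A ∪ B ∧ v ∈ A ∪ B)) {p : PathSig G} (hp : p ∈ P) :
    IsTerminalPath A B p where
  fst_mem := hP.fst_mem hp
  snd_mem := hP.snd_mem hp
  vert_notMem := hP.vert_notMem hAB hA hB hp
  two_le_length := hP.two_le_length hnoedge hp

variable [Fintype V] {σ : Equiv.Perm (GallaiVertex A B)}
  (hP : IsPerfectABPacking G A B P) (hterm : ∀ p ∈ P, IsTerminalPath A B p)
  (hσ : IsMatching G σ) (hfol : ∀ p ∈ P, Follows σ p)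

include hP hterm hσ hfol

omit hσ in
@[to_additive]
lemma prod_eq_prod_follows {M : Type*} [CommMonoid M] (F : GallaiVertex A B → M) :
    ∏ x, F x =
      (∏ p ∈ P, ∏ i ∈ Finset.range (length p), F (orbit σ p.1 i) * F (σ (orbit σ p.1 i))) *
        ∏ x ∈ Finset.univ.filter (fun x => ¬ ∃ p ∈ P, base x ∈ support p), F x := by
  rw [← Finset.prod_filter_mul_prod_filter_not Finset.univ
    (fun x => ∃ p ∈ P, base x ∈ support p)]
  congr 1
  have hset : Finset.univ.filter (fun x : GallaiVertex A B => ∃ p ∈ P, base x ∈ support p) =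
      P.biUnion fun p => Finset.univ.filter (fun x => base x ∈ support p) := by
    ext x
    simp
  rw [hset, Finset.prod_biUnion]
  · exact Finset.prod_congr rfl fun p hp => (hfol p hp).prod_support (hterm p hp) F
  · intro p hp q hq hpq
    rw [Function.onFun, Finset.disjoint_left]
    intro x hx hx'
    simp only [Finset.mem_filter, Finset.mem_univ, true_and] at hx hx'
    exact hpq (hP.eq_of_mem_support hp hq hx hx')

lemma totalWeight_eq (w : Sym2 V → ℕ) :
    totalWeight w σ = 2 * packingWeight w P +
      ∑ x ∈ Finset.univ.filter (fun x => ¬ ∃ p ∈ P, base x ∈ support p), weight w x (σ x) := by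
  rw [totalWeight, sum_eq_sum_follows hP hterm hfol]
  congr 1
  rw [packingWeight, Finset.mul_sum]
  refine Finset.sum_congr rfl fun p hp => ?_
  rw [sum_edges, Finset.mul_sum]
  refine Finset.sum_congr rfl fun i hi => ?_
  have hi := Finset.mem_range.1 hi
  rw [hσ.involutive, weight_comm w (σ _), ← two_mul, weight, (hfol p hp).base_apply hi,
    hfol p hp i hi.le, if_neg (adj_vert p hi).ne]

lemma totalSign_eq (hAB : Disjoint A B) (hA : Even A.card) (hB : Even B.card) :
    totalSign σ = (-1) ^ thetaB B P := by
  rw [totalSign, prod_eq_prod_follows hP hterm hfol, Finset.prod_eq_one (s := Finset.filter _ _),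
    mul_one, thetaB, ← Finset.prod_const, Finset.prod_filter]
  · refine Finset.prod_congr rfl fun p hp => ?_
    simp only [hσ.involutive]
    rw [(hfol p hp).prod_sign hσ (hterm p hp)]
    rcases hP.2.1 p hp with h | h
    · exact iff_of_false (Finset.disjoint_left.1 hAB h.1) (Finset.disjoint_left.1 hAB h.2)
    · exact iff_of_true h.1 h.2
  · intro x hx
    rw [sign, if_neg]
    rintro ⟨hxB, -⟩
    simp only [Finset.mem_filter, Finset.mem_univ, true_and] at hx
    obtain ⟨p, hp, h | h⟩ := hP.exists_end hAB hA hB (Finset.mem_union_right A hxB)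
    · exact hx ⟨p, hp, by rw [h, ← vert_zero]; exact vert_mem p 0⟩
    · exact hx ⟨p, hp, by rw [h, ← vert_length]; exact vert_mem p _⟩

lemma isPure_of_follows (hAB : Disjoint A B) (hA : Even A.card) (hB : Even B.card) :
    IsPure G σ := by
  refine ⟨hσ, Finset.filter_eq_empty_iff.2 ?_⟩
  intro t ht htB
  obtain ⟨p, hp, rfl | rfl⟩ := hP.exists_end hAB hA hB (Finset.mem_union_left B ht)
  · rw [(hfol p hp).partner_eq (hterm p hp)] at htB
    rcases hP.2.1 p hp with h | h
    · exact Finset.disjoint_left.1 hAB h.2 htB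
    · exact Finset.disjoint_left.1 hAB ht h.1
  · rw [← (hfol p hp).partner_eq (hterm p hp), partner_partner swap_swap hσ.involutive
      (swap_inl (hterm p hp).fst_mem)] at htB
    rcases hP.2.1 p hp with h | h
    · exact Finset.disjoint_left.1 hAB h.1 htB
    · exact Finset.disjoint_left.1 hAB ht h.2

end

section

variable {V : Type*} [Fintype V] [DecidableEq V] {G : SimpleGraph V} {A B : Finset V}
  {σ : Equiv.Perm (GallaiVertex A B)} (hσ : IsMatching G σ) {t : V} (ht : t ∈ A ∪ B)

include hσ ht

omit [Fintype V] in
lemma IsMatching.apply_orbit_ne_swap (i : ℕ) : σ (orbit σ t i) ≠ swap A B (orbit σ t i) := by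
  intro h
  have h1 : ((swap A B * σ) ^ i) ((swap A B * σ) (Sum.inl t)) =
      ((swap A B * σ) ^ i) (Sum.inl t) := by
    rw [← Equiv.Perm.mul_apply, ← pow_succ]
    change orbit σ t (i + 1) = orbit σ t i
    rw [orbit_succ, h, swap_swap]
  have h2 := congrArg (swap A B) (((swap A B * σ) ^ i).injective h1)
  rw [Equiv.Perm.mul_apply, swap_swap, swap_inl ht] at h2
  exact hσ.fixedPointFree _ h2

lemma IsMatching.base_orbit_injOn :
    Set.InjOn (fun i => base (orbit σ t i)) {i | i ≤ returnTime (swap A B) σ (Sum.inl t)} := by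
  have key : ∀ i j, i < j → j ≤ returnTime (swap A B) σ (Sum.inl t) →
      base (orbit σ t i) ≠ base (orbit σ t j) := by
    intro i j hij hj h
    rcases base_eq_iff.1 h with h | h
    · exact pow_ne_pow swap_swap hσ.involutive hσ.fixedPointFree (swap_inl ht) hij hj h
    · exact pow_ne_map_pow swap_swap hσ.involutive hσ.fixedPointFree (swap_inl ht) hij hj h
  intro i hi j hj h
  rcases lt_trichotomy i j with hij | hij | hij
  · exact absurd h (key i j hij hj)
  · exact hij
  · exact absurd h.symm (key j i hij hi)

lemma IsMatching.exists_follows : ∃ p : PathSig G, p.1 = t ∧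
    p.2.1 = base (partner (swap A B) σ (Sum.inl t)) ∧ Follows σ p := by
  have hadj : ∀ i, G.Adj (base (orbit σ t i)) (base (orbit σ t (i + 1))) := by
    intro i
    rw [orbit_succ, base_swap]
    exact (hσ.hAdj _).adj (hσ.apply_orbit_ne_swap ht i)
  let q := SimpleGraph.Walk.ofSeq (fun i => base (orbit σ t i)) hadj
    (returnTime (swap A B) σ (Sum.inl t))
  have hlen : q.length = returnTime (swap A B) σ (Sum.inl t) :=
    SimpleGraph.Walk.length_ofSeq _ _ _
  have hvert : ∀ i ≤ q.length, q.getVert i = base (orbit σ t i) := fun i hi =>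
    SimpleGraph.Walk.getVert_ofSeq _ _ (hlen ▸ hi)
  have hpath : q.IsPath := by
    rw [← SimpleGraph.Walk.IsPath.getVert_injOn_iff]
    intro i hi j hj h
    rw [hvert i hi, hvert j hj] at h
    exact hσ.base_orbit_injOn ht (hlen ▸ hi) (hlen ▸ hj) h
  exact ⟨⟨_, _, q, hpath⟩, rfl, rfl, fun i hi => (hvert i hi).symm⟩

lemma IsMatching.eq_or_eq_base_partner {s : V} (hs : s ∈ A ∪ B) {i j : ℕ}
    (h : base (orbit σ t i) = base (orbit σ s j)) :
    s = t ∨ s = base (partner (swap A B) σ (Sum.inl t)) := by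
  have h1 : (swap A B * σ).SameCycle (Sum.inl t) (orbit σ t i) := ⟨i, by simp [orbit]⟩
  have h2 : (swap A B * σ).SameCycle (Sum.inl s) (orbit σ s j) := ⟨j, by simp [orbit]⟩
  have h3 : (swap A B * σ).SameCycle (Sum.inl s) (orbit σ t i) := by
    rcases base_eq_iff.1 h with h | h
    · rwa [h]
    · rw [h]
      exact sameCycle_map swap_swap hσ.involutive (swap_inl hs) h2
  rcases (sameCycle_iff swap_swap hσ.involutive (swap_inl ht) (swap_inl hs)).1
    (h1.trans h3.symm) with h | h
  · exact Or.inl (Sum.inl_injective h)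
  · exact Or.inr (congrArg base h)

omit hσ in
lemma inl_base_partner :
    Sum.inl (base (partner (swap A B) σ (Sum.inl t))) = partner (swap A B) σ (Sum.inl t) :=
  (eq_inl_of_base_mem (IsMatching.base_partner_mem ht)).symm

lemma IsMatching.base_partner_base_partner :
    base (partner (swap A B) σ (Sum.inl (base (partner (swap A B) σ (Sum.inl t))))) = t := by
  rw [inl_base_partner ht, partner_partner swap_swap hσ.involutive (swap_inl ht)]
  rfl

lemma IsMatching.base_partner_ne : base (partner (swap A B) σ (Sum.inl t)) ≠ t := by
  intro h
  refine partner_ne swap_swap hσ.involutive hσ.fixedPointFree (swap_inl ht) ?_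
  rw [← inl_base_partner ht, h]

end

section

variable {V : Type*} [Fintype V] [LinearOrder V] {G : SimpleGraph V} {A B : Finset V}
  {σ : Equiv.Perm (GallaiVertex A B)}

lemma IsMatching.two_mul_card_filter_lt_partner (hσ : IsMatching G σ) :
    2 * ((A ∪ B).attach.filter
      fun t => t.1 < base (partner (swap A B) σ (Sum.inl t.1))).card = (A ∪ B).card := by
  have hinv : Function.Involutive fun t : {t // t ∈ A ∪ B} =>
      (⟨base (partner (swap A B) σ (Sum.inl t.1)), base_partner_mem t.2⟩ : {t // t ∈ A ∪ B}) :=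
    fun t => Subtype.ext (hσ.base_partner_base_partner t.2)
  have h := sum_univ_eq_sum_filter_lt (e := fun t : {t // t ∈ A ∪ B} => t.1)
    Subtype.val_injective (σ := hinv.toPerm) hinv
    (fun t ht => hσ.base_partner_ne t.2 (congrArg Subtype.val ht)) (fun _ => 1)
  simp only [Finset.sum_const, Finset.card_univ, Fintype.card_coe, smul_eq_mul, mul_one] at h
  rw [h, mul_comm, Finset.univ_eq_attach]
  rfl

lemma IsPure.exists_packing (h : IsPure G σ) (hAB : Disjoint A B) (hA : Even A.card)
    (hB : Even B.card) : ∃ P, IsPerfectABPacking G A B P ∧ ∀ p ∈ P, Follows σ p := by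
  obtain ⟨hσ, hmix⟩ := h
  choose path hfst hsnd hfol using fun t : {t // t ∈ A ∪ B} => hσ.exists_follows t.2
  have hinj : Function.Injective path := fun s t hst =>
    Subtype.ext (by rw [← hfst, hst, hfst])
  have hmixed : ∀ t ∈ A, base (partner (swap A B) σ (Sum.inl t)) ∉ B := by
    intro t ht htB
    have : t ∈ mixed σ := Finset.mem_filter.2 ⟨ht, htB⟩
    simp [hmix] at this
  refine ⟨((A ∪ B).attach.filter
    fun t => t.1 < base (partner (swap A B) σ (Sum.inl t.1))).image path, ⟨?_, ?_, ?_, ?_⟩, ?_⟩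
  · intro p hp
    obtain ⟨t, ht, rfl⟩ := Finset.mem_image.1 hp
    rw [hsnd, hfst]
    exact (Finset.mem_filter.1 ht).2
  · intro p hp
    obtain ⟨t, -, rfl⟩ := Finset.mem_image.1 hp
    rw [hsnd, hfst]
    have ht' := Finset.mem_union.1 (IsMatching.base_partner_mem (σ := σ) t.2)
    rcases Finset.mem_union.1 t.2 with ht | ht
    · exact Or.inl ⟨ht, ht'.resolve_right (hmixed t ht)⟩
    · refine Or.inr ⟨ht, ht'.resolve_left fun hA' => hmixed _ hA' ?_⟩
      rwa [hσ.base_partner_base_partner t.2]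
  · intro p hp q hq hpq v hvp hvq
    obtain ⟨t, ht, rfl⟩ := Finset.mem_image.1 hp
    obtain ⟨s, hs, rfl⟩ := Finset.mem_image.1 hq
    obtain ⟨i, hi, rfl⟩ := (mem_support_iff _).1 hvp
    obtain ⟨j, hj, hv⟩ := (mem_support_iff _).1 hvq
    rw [← hfol t i hi, ← hfol s j hj, hfst, hfst] at hv
    rcases hσ.eq_or_eq_base_partner t.2 s.2 hv with h | h
    · exact hpq (congrArg path (Subtype.ext h.symm))
    · have h1 := (Finset.mem_filter.1 ht).2
      have h2 := (Finset.mem_filter.1 hs).2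
      rw [h, hσ.base_partner_base_partner t.2] at h2
      exact h1.asymm h2
  · rw [Finset.card_image_of_injective _ hinj]
    have h1 := hσ.two_mul_card_filter_lt_partner
    rw [Finset.card_union_of_disjoint hAB] at h1
    have h2 := Nat.two_mul_div_two_of_even hA
    have h3 := Nat.two_mul_div_two_of_even hB
    omega
  · intro p hp
    obtain ⟨t, -, rfl⟩ := Finset.mem_image.1 hp
    exact hfol t

end

section

variable {V : Type*} [DecidableEq V] {G : SimpleGraph V} {A B : Finset V}

/-- A perfect matching of the auxiliary graph which projects onto the paths in `P` and pairs every
vertex outside of these paths with its copy. -/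
structure IsTight (P : Finset (PathSig G)) (σ : Equiv.Perm (GallaiVertex A B)) : Prop where
  isMatching : IsMatching G σ
  follows : ∀ p ∈ P, Follows σ p
  apply_eq_swap : ∀ x : GallaiVertex A B, (¬ ∃ p ∈ P, base x ∈ support p) → σ x = swap A B x

variable {P : Finset (PathSig G)} (hterm : ∀ p ∈ P, IsTerminalPath A B p)

include hterm

lemma IsTight.eq_of_isRight_eq {σ τ : Equiv.Perm (GallaiVertex A B)} (hσ : IsTight P σ)
    (hτ : IsTight P τ)
    (h : ∀ p ∈ P, (σ (Sum.inl p.1)).isRight = (τ (Sum.inl p.1)).isRight) : σ = τ := by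
  have horb : ∀ p ∈ P, ∀ i ≤ length p, orbit σ p.1 i = orbit τ p.1 i := by
    intro p hp i hi
    have hfσ := hσ.follows p hp
    have hfτ := hτ.follows p hp
    rcases i with _ | i
    · rfl
    rcases hi.lt_or_eq with hi' | hi'
    · refine eq_of_base_eq_of_isRight_eq ?_ ?_
      · rw [hfσ _ hi, hfτ _ hi]
      · rw [hfσ.isRight_orbit hσ.isMatching (hterm p hp) hi',
          hfτ.isRight_orbit hτ.isMatching (hterm p hp) hi', h p hp]
    · rw [hi', (hterm p hp).eq_inl_length hfσ, (hterm p hp).eq_inl_length hfτ]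
  ext1 x
  by_cases hx : ∃ p ∈ P, base x ∈ support p
  · obtain ⟨p, hp, hx⟩ := hx
    rcases (hterm p hp).eq_or_eq_swap (hσ.follows p hp) hx with ⟨i, hi, rfl⟩ | ⟨i, hi, rfl⟩
    · rw [← swap_orbit_succ, horb p hp _ hi, horb p hp i hi.le, swap_orbit_succ]
    · rw [swap_orbit_succ, hσ.isMatching.involutive, ← swap_orbit_succ, horb p hp _ hi,
        swap_orbit_succ, hτ.isMatching.involutive, horb p hp i hi.le]
  · rw [hσ.apply_eq_swap x hx, hτ.apply_eq_swap x hx]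

end

section

variable {V : Type*} [LinearOrder V] {G : SimpleGraph V} {A B : Finset V}
  {P : Finset (PathSig G)}

lemma exists_involutive_of_packing (hP : IsPerfectABPacking G A B P)
    (hterm : ∀ p ∈ P, IsTerminalPath A B p) {y : PathSig G → ℕ → GallaiVertex A B}
    (hy : ∀ p ∈ P, ∀ i ≤ length p, base (y p i) = vert p i) :
    ∃ f : GallaiVertex A B → GallaiVertex A B, Function.Involutive f ∧
      (∀ p ∈ P, ∀ i < length p, f (y p i) = swap A B (y p (i + 1))) ∧
      ∀ x, (¬ ∃ p ∈ P, base x ∈ support p) → f x = swap A B x := by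
  let R : GallaiVertex A B → GallaiVertex A B → Prop := fun x z =>
    (∃ p ∈ P, ∃ i < length p, (x = y p i ∧ z = swap A B (y p (i + 1))) ∨
      (x = swap A B (y p (i + 1)) ∧ z = y p i)) ∨
    ((¬ ∃ p ∈ P, base x ∈ support p) ∧ z = swap A B x)
  have hex : ∀ x, ∃ z, R x z := by
    intro x
    by_cases hx : ∃ p ∈ P, base x ∈ support p
    · obtain ⟨p, hp, hx⟩ := hx
      rcases (hterm p hp).eq_or_eq_swap (hy p hp) hx with ⟨i, hi, rfl⟩ | ⟨i, hi, rfl⟩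
      · exact ⟨_, Or.inl ⟨p, hp, i, hi, Or.inl ⟨rfl, rfl⟩⟩⟩
      · exact ⟨_, Or.inl ⟨p, hp, i, hi, Or.inr ⟨rfl, rfl⟩⟩⟩
    · exact ⟨_, Or.inr ⟨hx, rfl⟩⟩
  have hsymm : ∀ x z, R x z → R z x := by
    rintro x z (⟨p, hp, i, hi, ⟨rfl, rfl⟩ | ⟨rfl, rfl⟩⟩ | ⟨hx, rfl⟩)
    · exact Or.inl ⟨p, hp, i, hi, Or.inr ⟨rfl, rfl⟩⟩
    · exact Or.inl ⟨p, hp, i, hi, Or.inl ⟨rfl, rfl⟩⟩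
    · exact Or.inr ⟨by rwa [base_swap], (swap_swap x).symm⟩
  have hmem : ∀ {x p i}, p ∈ P → i < length p → x = y p i ∨ x = swap A B (y p (i + 1)) →
      base x ∈ support p := by
    rintro x p i hp hi (rfl | rfl)
    · rw [hy p hp i hi.le]
      exact vert_mem p i
    · rw [base_swap, hy p hp _ hi]
      exact vert_mem p _
  have huniq : ∀ x z z', R x z → R x z' → z = z' := by
    rintro x z z' (⟨p, hp, i, hi, h⟩ | ⟨hx, rfl⟩) (⟨q, hq, j, hj, h'⟩ | ⟨hx', rfl⟩)
    · have hpq := hP.eq_of_mem_support hp hq (hmem hp hi (h.imp And.left And.left))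
        (hmem hq hj (h'.imp And.left And.left))
      subst hpq
      rcases h with ⟨rfl, rfl⟩ | ⟨rfl, rfl⟩ <;> rcases h' with ⟨h', rfl⟩ | ⟨h', rfl⟩
      · rw [IsTerminalPath.seq_inj (hy p hp) hi.le hj.le h']
      · exact absurd h' ((hterm p hp).ne_swap (hy p hp) hi hj)
      · exact absurd h'.symm ((hterm p hp).ne_swap (hy p hp) hj hi)
      · have := IsTerminalPath.seq_inj (hy p hp) hi hj ((swap A B).injective h')
        rw [Nat.succ_injective this]
    · exact absurd ⟨p, hp, hmem hp hi (h.imp And.left And.left)⟩ hx'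
    · exact absurd ⟨q, hq, hmem hq hj (h'.imp And.left And.left)⟩ hx
    · rfl
  choose f hf using hex
  exact ⟨f, fun x => huniq _ _ _ (hf _) (hsymm _ _ (hf x)),
    fun p hp i hi => huniq _ _ _ (hf _) (Or.inl ⟨p, hp, i, hi, Or.inl ⟨rfl, rfl⟩⟩),
    fun x hx => huniq _ _ _ (hf x) (Or.inr ⟨hx, rfl⟩)⟩

lemma exists_isTight (hP : IsPerfectABPacking G A B P)
    (hterm : ∀ p ∈ P, IsTerminalPath A B p)
    (hend : ∀ t ∈ A ∪ B, ∃ p ∈ P, t ∈ support p) (ε : PathSig G → Bool) :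
    ∃ σ : Equiv.Perm (GallaiVertex A B), IsTight P σ ∧
      ∀ p ∈ P, (σ (Sum.inl p.1)).isRight = ε p := by
  let y : PathSig G → ℕ → GallaiVertex A B := fun p i =>
    lift A B (vert p i) (ε p ^^ decide (Odd i))
  have hy : ∀ p ∈ P, ∀ i ≤ length p, base (y p i) = vert p i := fun p _ i _ => base_lift _ _
  have hyswap : ∀ p i, swap A B (y p (i + 1)) =
      lift A B (vert p (i + 1)) (ε p ^^ decide (Odd i)) := by
    intro p i
    rw [swap_lift]
    congr 1
    by_cases h : Odd i <;> simp [h, Nat.odd_add_one]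
  obtain ⟨f, hf, hfon, hfoff⟩ := exists_involutive_of_packing hP hterm hy
  have hadj : ∀ p ∈ P, ∀ i < length p, HAdj G (y p i) (f (y p i)) := by
    intro p hp i hi
    rw [hfon p hp i hi, hyswap]
    exact hAdj_lift (adj_vert p hi) _
  have hy0 : ∀ p ∈ P, y p 0 = Sum.inl p.1 := fun p hp => (hterm p hp).eq_inl_zero (hy p hp)
  refine ⟨hf.toPerm, ⟨⟨hf, fun x => ?_⟩, fun p hp => ?_, hfoff⟩, fun p hp => ?_⟩
  · change HAdj G x (f x)
    by_cases hx : ∃ p ∈ P, base x ∈ support p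
    · obtain ⟨p, hp, hx⟩ := hx
      rcases (hterm p hp).eq_or_eq_swap (hy p hp) hx with ⟨i, hi, rfl⟩ | ⟨i, hi, rfl⟩
      · exact hadj p hp i hi
      · rw [← hfon p hp i hi, hf]
        exact (hadj p hp i hi).symm
    · rw [hfoff x hx]
      exact Or.inl ⟨(base_swap x).symm, fun h => hx (hend _ (swap_eq_self_iff.1 h.symm))⟩
  · have horb : ∀ i ≤ length p, orbit hf.toPerm p.1 i = y p i := by
      intro i
      induction i with
      | zero => exact fun _ => (hy0 p hp).symm
      | succ i ih =>
        intro hi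
        rw [orbit_succ, ih (by omega), Function.Involutive.coe_toPerm, hfon p hp i hi, swap_swap]
    intro i hi
    rw [horb i hi, hy p hp i hi]
  · have h2 := (hterm p hp).two_le_length
    rw [Function.Involutive.coe_toPerm, ← hy0 p hp, hfon p hp 0 (by omega), hyswap,
      isRight_lift ((hterm p hp).vert_notMem (by omega) (by omega)),
      decide_eq_false Nat.not_odd_zero, Bool.xor_false]

lemma card_isTight [Fintype V] (hP : IsPerfectABPacking G A B P)
    (hterm : ∀ p ∈ P, IsTerminalPath A B p)
    (hend : ∀ t ∈ A ∪ B, ∃ p ∈ P, t ∈ support p) :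
    (Finset.univ.filter fun σ : Equiv.Perm (GallaiVertex A B) => IsTight P σ).card =
      2 ^ P.card := by
  rw [← Finset.card_powerset]
  refine Finset.card_bij (fun σ _ => P.filter fun p => (σ (Sum.inl p.1)).isRight = true) ?_ ?_ ?_
  · exact fun σ _ => Finset.mem_powerset.2 (Finset.filter_subset _ _)
  · intro σ hσ τ hτ h
    refine IsTight.eq_of_isRight_eq hterm (Finset.mem_filter.1 hσ).2 (Finset.mem_filter.1 hτ).2 ?_
    intro p hp
    have := Finset.ext_iff.1 h p
    simp only [Finset.mem_filter, hp, true_and] at this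
    exact Bool.eq_iff_iff.2 this
  · intro T hT
    obtain ⟨σ, hσ, hε⟩ := exists_isTight hP hterm hend fun p => decide (p ∈ T)
    refine ⟨σ, Finset.mem_filter.2 ⟨Finset.mem_univ _, hσ⟩, ?_⟩
    ext p
    constructor
    · intro hp
      obtain ⟨hp, hp'⟩ := Finset.mem_filter.1 hp
      rw [hε p hp] at hp'
      exact of_decide_eq_true hp'
    · intro hp
      have hpP := Finset.mem_powerset.1 hT hp
      exact Finset.mem_filter.2 ⟨hpP, by rw [hε p hpP]; exact decide_eq_true hp⟩

end

section

variable {V : Type*} [Fintype V] [LinearOrder V] {G : SimpleGraph V} {A B : Finset V}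
  {w : Sym2 V → ℕ} {P : Finset (PathSig G)}

lemma packingWeight_lt_of_ne (hAB : Disjoint A B) (hA : Even A.card) (hB : Even B.card)
    (hnoedge : ∀ u v : V, G.Adj u v → ¬(u ∈ A ∪ B ∧ v ∈ A ∪ B))
    (huniq : ∀ Q : Finset (PathSig G), IsPerfectABPacking G A B Q → Q ≠ P →
      packingWeight w P < packingWeight w Q) {σ : Equiv.Perm (GallaiVertex A B)}
    (hσ : IsPure G σ) (hne : ¬ ∀ p ∈ P, Follows σ p) :
    packingWeight w P < totalWeight w σ / 2 := by
  obtain ⟨Q, hQ, hfol⟩ := hσ.exists_packing hAB hA hB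
  have hlt := huniq Q hQ (fun h => hne (h ▸ hfol))
  have := totalWeight_eq hQ (fun _ hp => hQ.isTerminalPath hAB hA hB hnoedge hp) hσ.1 hfol w
  omega

omit [Fintype V] in
lemma IsMatching.apply_eq_swap_of_weight_eq_zero (hw : ∀ e ∈ G.edgeSet, 0 < w e)
    {σ : Equiv.Perm (GallaiVertex A B)} (hσ : IsMatching G σ) {x : GallaiVertex A B}
    (hx : weight w x (σ x) = 0) : σ x = swap A B x := by
  by_contra h
  have hadj := (hσ.hAdj x).adj h
  rw [weight, if_neg hadj.ne] at hx
  exact (hw _ hadj).ne' hx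

variable (hP : IsPerfectABPacking G A B P) (hterm : ∀ p ∈ P, IsTerminalPath A B p)

include hP hterm

lemma IsTight.totalWeight_eq {σ : Equiv.Perm (GallaiVertex A B)} (hσ : IsTight P σ)
    (w : Sym2 V → ℕ) : totalWeight w σ = 2 * packingWeight w P := by
  rw [GallaiVertex.totalWeight_eq hP hterm hσ.isMatching hσ.follows, Finset.sum_eq_zero, add_zero]
  intro x hx
  rw [hσ.apply_eq_swap x (Finset.mem_filter.1 hx).2, weight, if_pos (base_swap x).symm]

lemma packingWeight_lt_of_not_isTight (hw : ∀ e ∈ G.edgeSet, 0 < w e)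
    {σ : Equiv.Perm (GallaiVertex A B)} (hσ : IsMatching G σ) (hfol : ∀ p ∈ P, Follows σ p)
    (hne : ¬ IsTight P σ) : packingWeight w P < totalWeight w σ / 2 := by
  have h1 := totalWeight_eq hP hterm hσ hfol w
  have h2 := hσ.totalWeight_eq_two_mul w
  have h3 : ∑ x ∈ Finset.univ.filter (fun x => ¬ ∃ p ∈ P, base x ∈ support p),
      weight w x (σ x) ≠ 0 := by
    intro h0
    refine hne ⟨hσ, hfol, fun x hx => hσ.apply_eq_swap_of_weight_eq_zero hw ?_⟩
    exact Finset.sum_eq_zero_iff.1 h0 x (Finset.mem_filter.2 ⟨Finset.mem_univ _, hx⟩)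
  omega

omit hterm

lemma coeff_haf_gallaiSP [DecidableRel G.Adj] (hw : ∀ e ∈ G.edgeSet, 0 < w e)
    (hAB : Disjoint A B) (hA : Even A.card) (hB : Even B.card)
    (hnoedge : ∀ u v : V, G.Adj u v → ¬(u ∈ A ∪ B ∧ v ∈ A ∪ B))
    (huniq : ∀ Q : Finset (PathSig G), IsPerfectABPacking G A B Q → Q ≠ P →
      packingWeight w P < packingWeight w Q) {d : ℕ} (hd : d ≤ packingWeight w P) :
    (haf (gallaiSP G w A B)).coeff d =
      if d = packingWeight w P then (-1) ^ thetaB B P * 2 ^ ((A.card + B.card) / 2) else 0 := by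
  have hterm : ∀ p ∈ P, IsTerminalPath A B p := fun _ hp =>
    hP.isTerminalPath hAB hA hB hnoedge hp
  have hend : ∀ t ∈ A ∪ B, ∃ p ∈ P, t ∈ support p := by
    intro t ht
    obtain ⟨p, hp, rfl | rfl⟩ := hP.exists_end hAB hA hB ht
    · exact ⟨p, hp, p.2.2.1.start_mem_support⟩
    · exact ⟨p, hp, p.2.2.1.end_mem_support⟩
  have hcard : P.card = (A.card + B.card) / 2 := by
    rw [hP.2.2.2, Nat.add_div_of_dvd_right hA.two_dvd]
  have hlt : ∀ σ : Equiv.Perm (GallaiVertex A B), IsPure G σ → ¬ IsTight P σ →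
      packingWeight w P < totalWeight w σ / 2 := by
    intro σ hσ hne
    by_cases hfol : ∀ p ∈ P, Follows σ p
    · exact packingWeight_lt_of_not_isTight hP hterm hw hσ.1 hfol hne
    · exact packingWeight_lt_of_ne hAB hA hB hnoedge huniq hσ hfol
  rw [haf_gallaiSP_eq_sum_isPure w hAB hnoedge, Polynomial.finsetSum_coeff,
    ← Finset.sum_subset (s₁ := Finset.univ.filter fun σ : Equiv.Perm (GallaiVertex A B) =>
      IsTight P σ),
    Finset.sum_congr rfl (g := fun _ => if d = packingWeight w P then (-1) ^ thetaB B P else 0),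
    Finset.sum_const, card_isTight hP hterm hend, hcard]
  · split_ifs <;> simp [mul_comm]
  · intro σ hσ
    have hσ := (Finset.mem_filter.1 hσ).2
    rw [Polynomial.coeff_C_mul_X_pow, hσ.totalWeight_eq hP hterm,
      totalSign_eq hP hterm hσ.isMatching hσ.follows hAB hA hB, Nat.mul_div_cancel_left _ two_pos]
  · intro σ hσ
    have hσ := (Finset.mem_filter.1 hσ).2
    exact Finset.mem_filter.2 ⟨Finset.mem_univ _,
      isPure_of_follows hP hterm hσ.isMatching hσ.follows hAB hA hB⟩
  · intro σ hσ hσ'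
    have := hlt σ (Finset.mem_filter.1 hσ).2 fun h =>
      hσ' (Finset.mem_filter.2 ⟨Finset.mem_univ _, h⟩)
    rw [Polynomial.coeff_C_mul_X_pow, if_neg (by omega)]

end

end GallaiVertex

/-- Under the hypotheses of the Gallai construction (disjoint
terminal sets `A, B` of even cardinality, no edge of `G` with both endpoints in
`A ∪ B`, positive integral edge weights), with `τ = (|A|+|B|)/2`: if `G` has a
unique shortest perfect `(A+B)`-path packing `𝓟*`, then in `haf S' ∈ ℤ[x]` the
coefficient of `x^d` vanishes for all `d < w(𝓟*)`, the coefficient of `x^{w(𝓟*)}`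
equals `(−1)^{θ(𝓟*)} · 2^τ`; in particular `haf S'` is nonzero modulo `2^{τ+1}`
(and its lowest-degree term determines `w(𝓟*)`). -/
theorem haf_gallaiSP_unique {V : Type*} [Fintype V] [LinearOrder V]
    (G : SimpleGraph V) [DecidableRel G.Adj]
    (w : Sym2 V → ℕ) (hw : ∀ e ∈ G.edgeSet, 0 < w e)
    (A B : Finset V) (hAB : Disjoint A B)
    (hA : Even A.card) (hB : Even B.card)
    (hnoedge : ∀ u v : V, G.Adj u v → ¬(u ∈ A ∪ B ∧ v ∈ A ∪ B))
    (Pstar : Finset (PathSig G)) (hPstar : IsPerfectABPacking G A B Pstar)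
    (huniq : ∀ Q : Finset (PathSig G), IsPerfectABPacking G A B Q → Q ≠ Pstar →
      packingWeight w Pstar < packingWeight w Q) :
    (∀ d : ℕ, d < packingWeight w Pstar → (haf (gallaiSP G w A B)).coeff d = 0) ∧
    (haf (gallaiSP G w A B)).coeff (packingWeight w Pstar) =
      (-1) ^ thetaB B Pstar * 2 ^ ((A.card + B.card) / 2) ∧
    Polynomial.map (Int.castRingHom (ZMod (2 ^ ((A.card + B.card) / 2 + 1))))
      (haf (gallaiSP G w A B)) ≠ 0 := by
  have hcoeff : ∀ d ≤ packingWeight w Pstar, (haf (gallaiSP G w A B)).coeff d =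
      if d = packingWeight w Pstar then
        (-1) ^ thetaB B Pstar * 2 ^ ((A.card + B.card) / 2) else 0 := fun d hd =>
    GallaiVertex.coeff_haf_gallaiSP hPstar hw hAB hA hB hnoedge huniq hd
  have htop := hcoeff _ le_rfl
  rw [if_pos rfl] at htop
  refine ⟨fun d hd => by rw [hcoeff d hd.le, if_neg hd.ne], htop, fun h => ?_⟩
  have h0 := congrArg (fun f => f.coeff (packingWeight w Pstar)) h
  simp only [Polynomial.coeff_map, htop, Polynomial.coeff_zero, eq_intCast] at h0
  rw [ZMod.intCast_zmod_eq_zero_iff_dvd, IsUnit.dvd_mul_left ((isUnit_one.neg).pow _)] at h0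
  norm_cast at h0
  rw [Nat.pow_dvd_pow_iff_le_right one_lt_two] at h0
  omega
end

section
/- Let G = (V,E) be a simple undirected graph with positive integer edge weights w, let T = {1,…,2τ} ⊆ V with no edge of G joining two vertices of T, and let H and S (indexed by V_H = T ∪ U ∪ U') be as in the Gallai construction. For p, q ∈ ℤ^{2τ}, let S[p,q] be the symmetric matrix over ℤ[x] whose (i,j) entry is p_t s_{ij} if ij ∈ E_t for some t ∈ T, q_t s_{ij} if ij ∈ E'_t for some t ∈ T, and s_{ij} otherwise; for χ ∈ {0,1}^{2τ} set S(χ) := S[χ, 𝟙−χ]. Then haf S[p,q] = Σ_{χ ∈ {0,1}^{2τ}} ( Π_{i=1}^{2τ} (χ_i p_i + (1−χ_i) q_i) ) · haf S(χ). -/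
open scoped Classical

/-- The vertex set `V_H = V ⊔ U'` of Gallai's auxiliary graph `H` for a terminal
set `T` (given by an embedding `t : Fin (2τ) ↪ V`), where `U'` is a disjoint copy
of `U = V \ T`. -/
abbrev GallaiVertexT {V : Type*} {τ : ℕ} (t : Fin (2 * τ) ↪ V) : Type _ :=
  V ⊕ {v : V // ∀ i, t i ≠ v}

/-- The scaling factor attached to a vertex `u` of `V` by a vector
`c ∈ ℤ^{2τ}`: it is `c_i` if `u = t i` is the `i`-th terminal, and `1`
otherwise. -/
noncomputable def termScale {V : Type*} {τ : ℕ} (t : Fin (2 * τ) ↪ V)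
    (c : Fin (2 * τ) → ℤ) (u : V) : Polynomial ℤ :=
  if h : ∃ i, t i = u then Polynomial.C (c h.choose) else 1

/-- The matrix `S[p,q]` over `ℤ[x]` of the Gallai construction for terminal set
`T` (the range of `t`): indexed by `V_H`, with zero diagonal, and for each edge of
`H` the entry `x^{w(ij)}` (`E_=`-edges `v v'` have weight `0`, hence entry `1`),
where entries of edges in `E_t` (joining the terminal `t` to `U`) are multiplied
by `p_t` and entries of edges in `E'_t` (joining `t` to the copy `U'`) are
multiplied by `q_t`; all other entries are `0`. -/
noncomputable def gallaiS {V : Type*} [DecidableEq V] (G : SimpleGraph V)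
    [DecidableRel G.Adj] (w : Sym2 V → ℕ) {τ : ℕ} (t : Fin (2 * τ) ↪ V)
    (p q : Fin (2 * τ) → ℤ) :
    Matrix (GallaiVertexT t) (GallaiVertexT t) (Polynomial ℤ) :=
  Matrix.of fun a b =>
    match a, b with
    | Sum.inl u, Sum.inl v =>
        (if G.Adj u v then Polynomial.X ^ w s(u, v) else 0) *
          termScale t p u * termScale t p v
    | Sum.inl u, Sum.inr v =>
        if u = v.1 then 1
        else if (∃ i, t i = u) ∧ G.Adj u v.1 then
          termScale t q u * Polynomial.X ^ w s(u, v.1)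
        else 0
    | Sum.inr v, Sum.inl u =>
        if u = v.1 then 1
        else if (∃ i, t i = u) ∧ G.Adj u v.1 then
          termScale t q u * Polynomial.X ^ w s(u, v.1)
        else 0
    | Sum.inr u, Sum.inr v =>
        if G.Adj u.1 v.1 then Polynomial.X ^ w s(u.1, v.1) else 0

/-- The `{0,1}`-valued indicator of a Boolean, as an integer. -/
def ind : Bool → ℤ := fun b => if b then 1 else 0

/-- For a fixed-point-free involution `σ`, the product of `f` over all indices is the product over
the pairs `{i, σ i}` of `f i * f (σ i)`. -/
lemma prod_pairs_eq_prod {ι R : Type*} [Fintype ι] [CommRing R] (σ : Equiv.Perm ι)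
    (hσ : σ * σ = 1) (hfix : ∀ i, σ i ≠ i) (f : ι → R) :
    ∏ i ∈ Finset.univ.filter
        (fun i => Fintype.equivFin ι i < Fintype.equivFin ι (σ i)), f i * f (σ i) =
      ∏ i, f i := by
  have hinv : ∀ i, σ (σ i) = i := fun i => by
    simpa using congrArg (fun e : Equiv.Perm ι => e i) hσ
  have hne : ∀ i, Fintype.equivFin ι i ≠ Fintype.equivFin ι (σ i) := fun i h =>
    hfix i ((Fintype.equivFin ι).injective h).symm
  rw [Finset.prod_mul_distrib, ← Finset.prod_filter_mul_prod_filter_not Finset.univ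
    (fun i => Fintype.equivFin ι i < Fintype.equivFin ι (σ i)) f]
  congr 1
  refine Finset.prod_nbij' σ σ ?_ ?_ (fun i _ => hinv i) (fun i _ => hinv i) (fun _ _ => rfl)
  · intro i hi
    simp only [Finset.mem_filter, Finset.mem_univ, true_and, hinv] at hi ⊢
    exact hi.not_gt
  · intro i hi
    simp only [Finset.mem_filter, Finset.mem_univ, true_and, hinv] at hi ⊢
    exact lt_of_le_of_ne (not_lt.mp hi) (hne i).symm

/-- The effect on the hafnian of scaling each entry `(a, b)` by a factor `F a b` for the end `a`
and a factor `F b a` for the end `b`. -/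
lemma haf_of_apply_eq_mul {ι R : Type*} [Fintype ι] [CommRing R] (F : ι → ι → R)
    (M N : Matrix ι ι R) (hM : ∀ a b, M a b = F a b * F b a * N a b) :
    haf M =
      ∑ σ ∈ Finset.univ.filter (fun σ : Equiv.Perm ι => σ * σ = 1 ∧ ∀ i, σ i ≠ i),
        (∏ a, F a (σ a)) *
          ∏ a ∈ Finset.univ.filter
              (fun a => Fintype.equivFin ι a < Fintype.equivFin ι (σ a)),
            N a (σ a) := by
  unfold haf
  refine Finset.sum_congr rfl fun σ hσ => ?_
  obtain ⟨hσ, hfix⟩ := (Finset.mem_filter.mp hσ).2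
  have hinv : ∀ a, σ (σ a) = a := fun a => by
    simpa using congrArg (fun e : Equiv.Perm ι => e a) hσ
  rw [← prod_pairs_eq_prod σ hσ hfix, ← Finset.prod_mul_distrib]
  refine Finset.prod_congr rfl fun a _ => ?_
  rw [hM, hinv]

lemma termScale_apply {V : Type*} {τ : ℕ} (t : Fin (2 * τ) ↪ V) (c : Fin (2 * τ) → ℤ)
    (i : Fin (2 * τ)) : termScale t c (t i) = Polynomial.C (c i) := by
  have h : ∃ j, t j = t i := ⟨i, rfl⟩
  rw [termScale, dif_pos h, t.injective h.choose_spec]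

lemma termScale_of_forall_ne {V : Type*} {τ : ℕ} (t : Fin (2 * τ) ↪ V) (c : Fin (2 * τ) → ℤ)
    {u : V} (hu : ∀ i, t i ≠ u) : termScale t c u = 1 :=
  dif_neg fun ⟨i, hi⟩ => hu i hi

lemma termScale_one {V : Type*} {τ : ℕ} (t : Fin (2 * τ) ↪ V) (u : V) :
    termScale t (fun _ => 1) u = 1 := by
  unfold termScale
  split_ifs <;> simp

/-- The factor contributed to an entry `(a, b)` of `S[p,q]` by the vertex `a`. -/
noncomputable def endScale {V : Type*} {τ : ℕ} (t : Fin (2 * τ) ↪ V) (p q : Fin (2 * τ) → ℤ) :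
    GallaiVertexT t → GallaiVertexT t → Polynomial ℤ
  | Sum.inl u, Sum.inl _ => termScale t p u
  | Sum.inl u, Sum.inr _ => termScale t q u
  | Sum.inr _, _ => 1

lemma gallaiS_eq_endScale_mul {V : Type*} [DecidableEq V] (G : SimpleGraph V)
    [DecidableRel G.Adj] (w : Sym2 V → ℕ) {τ : ℕ} (t : Fin (2 * τ) ↪ V)
    (p q : Fin (2 * τ) → ℤ) (a b : GallaiVertexT t) :
    gallaiS G w t p q a b =
      endScale t p q a b * endScale t p q b a *
        gallaiS G w t (fun _ => 1) (fun _ => 1) a b := by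
  rcases a with u | u <;> rcases b with v | v
  · simp only [gallaiS, Matrix.of_apply, endScale, termScale_one]
    ring
  · simp only [gallaiS, Matrix.of_apply, endScale, termScale_one]
    split_ifs with h
    · rw [termScale_of_forall_ne t q (h ▸ v.2)]
      ring
    · ring
    · ring
  · simp only [gallaiS, Matrix.of_apply, endScale, termScale_one]
    split_ifs with h
    · rw [termScale_of_forall_ne t q (h ▸ u.2)]
      ring
    · ring
    · ring
  · simp only [gallaiS, Matrix.of_apply, endScale]
    ring

lemma prod_endScale {V : Type*} [Fintype V] [DecidableEq V] {τ : ℕ} (t : Fin (2 * τ) ↪ V)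
    (p q : Fin (2 * τ) → ℤ) (f : GallaiVertexT t → GallaiVertexT t) :
    ∏ a, endScale t p q a (f a) =
      Polynomial.C (∏ i, if (f (Sum.inl (t i))).isLeft then p i else q i) := by
  rw [Fintype.prod_sum_type, map_prod]
  have hr : ∏ v, endScale t p q (Sum.inr v) (f (Sum.inr v)) = 1 :=
    Finset.prod_eq_one fun _ _ => rfl
  rw [hr, mul_one]
  symm
  refine Fintype.prod_of_injective t t.injective _ _ ?_ ?_
  · intro u hu
    have hu' : ∀ i, t i ≠ u := fun i hi => hu ⟨i, hi⟩
    rcases h : f (Sum.inl u) with v | v <;> simp [endScale, termScale_of_forall_ne t _ hu']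
  · intro i
    rcases h : f (Sum.inl (t i)) with v | v <;> simp [endScale, termScale_apply]

/-- Multilinear expansion of a product of selected coordinates over `{0,1}`-vectors. -/
lemma sum_prod_ind_mul_prod {κ : Type*} [Fintype κ] [DecidableEq κ] (p q : κ → ℤ) (s : κ → Bool) :
    ∑ χ : κ → Bool, (∏ i, (ind (χ i) * p i + (1 - ind (χ i)) * q i)) *
        ∏ i, (if s i then ind (χ i) else 1 - ind (χ i)) =
      ∏ i, if s i then p i else q i := by
  simp_rw [← Finset.prod_mul_distrib]
  rw [← Fintype.prod_sum (fun i b =>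
    (ind b * p i + (1 - ind b) * q i) * (if s i then ind b else 1 - ind b))]
  refine Finset.prod_congr rfl fun i _ => ?_
  cases s i <;> simp [ind]

/-- Under the hypotheses of the Gallai construction for a
terminal set `T` of size `2τ` (no edge of `G` joining two terminals, positive
integral edge weights), for all `p, q ∈ ℤ^{2τ}`:
`haf S[p,q] = Σ_{χ ∈ {0,1}^{2τ}} (Π_i (χ_i p_i + (1−χ_i) q_i)) · haf S(χ)`,
where `S(χ) = S[χ, 𝟙−χ]` and vectors `χ ∈ {0,1}^{2τ}` are encoded as functions
`Fin (2τ) → Bool`. -/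
theorem haf_gallaiS_expansion {V : Type*} [Fintype V] [DecidableEq V]
    (G : SimpleGraph V) [DecidableRel G.Adj]
    (w : Sym2 V → ℕ) (hw : ∀ e ∈ G.edgeSet, 0 < w e)
    {τ : ℕ} (t : Fin (2 * τ) ↪ V)
    (hT : ∀ i j, ¬ G.Adj (t i) (t j))
    (p q : Fin (2 * τ) → ℤ) :
    haf (gallaiS G w t p q) =
      ∑ χ : Fin (2 * τ) → Bool,
        Polynomial.C (∏ i : Fin (2 * τ),
            (ind (χ i) * p i + (1 - ind (χ i)) * q i)) *
          haf (gallaiS G w t (fun i => ind (χ i)) (fun i => 1 - ind (χ i))) := by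
  have key := fun p q => haf_of_apply_eq_mul (endScale t p q) _ _
    (gallaiS_eq_endScale_mul G w t p q)
  simp_rw [key, prod_endScale, Finset.mul_sum]
  rw [Finset.sum_comm]
  refine Finset.sum_congr rfl fun σ _ => ?_
  simp_rw [← mul_assoc, ← map_mul]
  rw [← Finset.sum_mul, ← map_sum, sum_prod_ind_mul_prod p q fun i => (σ (Sum.inl (t i))).isLeft]
end
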